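/- arXiv:1310.4436 — 4 statements merged into one kernel-verified Lean document; each statement's English description precedes it below -/
import Mathlib

section
/- Let \(\mathsf{D}\) be a \(\Gamma\)-graded division ring (\(\Gamma\) a torsion-free abelian group) and let \(\mathsf{E}\subseteq\mathsf{D}\) be a graded subring that is itself a graded division ring. Then \([\mathsf{D}:\mathsf{E}] = [\mathsf{D}_0:\mathsf{E}_0]\cdot|\Gamma_{\mathsf{D}}:\Gamma_{\mathsf{E}}|\), where \([\mathsf{D}:\mathsf{E}]\) is the rank of \(\mathsf{D}\) as a free \(\mathsf{E}\)-module. -/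
noncomputable section

namespace GradedDivPaper

variable {Γ : Type*} [AddCommGroup Γ] [DecidableEq Γ]
variable {D : Type*} [Ring D]

/-- The (additive) group `Γ` is torsion-free. -/
def TorsionFree (Γ : Type*) [AddCommGroup Γ] : Prop :=
  ∀ (γ : Γ) (n : ℕ), n ≠ 0 → n • γ = 0 → γ = 0

/-- A `Γ`-graded ring is a graded division ring if `1 ≠ 0` and every nonzero
homogeneous element is a unit. -/
def IsGradedDivisionRing (𝒜 : Γ → AddSubgroup D) [GradedRing 𝒜] : Prop :=
  (0 : D) ≠ 1 ∧ ∀ (γ : Γ), ∀ x ∈ 𝒜 γ, x ≠ 0 → IsUnit x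

/-- A subring `E` of a graded ring is a graded subring if it contains all homogeneous
components of each of its elements. -/
def IsGradedSubring (𝒜 : Γ → AddSubgroup D) [GradedRing 𝒜] (E : Subring D) : Prop :=
  ∀ x ∈ E, ∀ γ : Γ, (DirectSum.decompose 𝒜 x γ : D) ∈ E

/-- A graded subring which is itself a graded division ring (nonzero homogeneous elements
of `E` are invertible in `E`). -/
def IsGradedDivSubring (𝒜 : Γ → AddSubgroup D) [GradedRing 𝒜] (E : Subring D) : Prop :=
  IsGradedSubring 𝒜 E ∧
    ∀ (γ : Γ), ∀ x ∈ E, x ∈ 𝒜 γ → x ≠ 0 → ∃ y ∈ E, x * y = 1 ∧ y * x = 1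

/-- A graded subfield: a commutative graded division subring. -/
def IsGradedSubfield (𝒜 : Γ → AddSubgroup D) [GradedRing 𝒜] (K : Subring D) : Prop :=
  IsGradedDivSubring 𝒜 K ∧ ∀ x ∈ K, ∀ y ∈ K, x * y = y * x

/-- The grade set `Γ_E` of a subring `E`: the degrees in which `E` has nonzero
homogeneous elements. -/
def gradeSet (𝒜 : Γ → AddSubgroup D) (E : Subring D) : Set Γ :=
  {γ : Γ | ∃ x : D, x ∈ E ∧ x ∈ 𝒜 γ ∧ x ≠ 0}

/-- The index `|A : B|` of subsets of `Γ`: the number of classes of `A` modulo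
translation by `B`. -/
def addSetIndex (A B : Set Γ) : ℕ :=
  Nat.card (Quot (fun x y : A => (x : Γ) - (y : Γ) ∈ B))

/-- `[R : S]`: the rank of the ring `R` as a module over a subring `S`. -/
def dimOver {R : Type*} [Ring R] (S : Subring R) : ℕ := Module.finrank S R

/-- `R` has finite rank over the subring `S`. -/
def finiteOver {R : Type*} [Ring R] (S : Subring R) : Prop := Module.Finite S R

/-- `[A : B]`: the rank of a subring `A` of `R` over a subring `B` (i.e. over `B ∩ A`). -/
def relDim {R : Type*} [Ring R] (B A : Subring R) : ℕ :=
  Module.finrank (B.comap A.subtype) A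

/-- The degree-0 component of a graded ring, as a subring. -/
def grade0 (𝒜 : Γ → AddSubgroup D) [GradedRing 𝒜] : Subring D where
  carrier := 𝒜 0
  zero_mem' := (𝒜 0).zero_mem
  add_mem' := fun ha hb => (𝒜 0).add_mem ha hb
  neg_mem' := fun ha => (𝒜 0).neg_mem ha
  one_mem' := SetLike.one_mem_graded 𝒜
  mul_mem' := fun ha hb => by simpa using SetLike.mul_mem_graded ha hb

/-- `L/F` is a Galois extension (inside an ambient ring `R`): `F ≤ L` and `F` is exactly
the fixed ring of the group of ring automorphisms of `L` fixing `F` pointwise. -/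
def IsGaloisExt {R : Type*} [Ring R] (F L : Subring R) : Prop :=
  F ≤ L ∧ ∀ x : L,
    (∀ σ : L ≃+* L, (∀ y : L, (y : R) ∈ F → σ y = y) → σ x = x) → (x : R) ∈ F

/-- `p` is the minimal polynomial of `c` over the subring `F`: the monic polynomial with
coefficients in `F` annihilating `c` of least degree. -/
def IsMinPolyOf {R : Type*} [Ring R] (F : Subring R) (c : R) (p : Polynomial F) : Prop :=
  p.Monic ∧ Polynomial.eval₂ F.subtype c p = 0 ∧
    ∀ q : Polynomial F, q.Monic → Polynomial.eval₂ F.subtype c q = 0 → p.degree ≤ q.degree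

/-- The polynomial `p` over `F` splits into linear factors over `L`. -/
def SplitsIn {R : Type*} [Ring R] {F L : Subring R} (h : F ≤ L) (p : Polynomial F) : Prop :=
  ∃ s : List L,
    p.map (Subring.inclusion h) = (s.map fun a => Polynomial.X - Polynomial.C a).prod

/-- Normality for an extension of graded subfields: the minimal polynomial over `F` of
every homogeneous element of `L` splits over `L`. -/
def IsNormalExtGr (𝒜 : Γ → AddSubgroup D) [GradedRing 𝒜] (F L : Subring D) : Prop :=
  ∃ h : F ≤ L, ∀ c ∈ L, (∃ γ : Γ, c ∈ 𝒜 γ) →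
    ∀ p : Polynomial F, IsMinPolyOf F c p → SplitsIn h p

/-- Normality for an (ungraded) extension of subfields: the minimal polynomial over `F`
of every element of `L` splits over `L`. -/
def IsNormalExt {R : Type*} [Ring R] (F L : Subring R) : Prop :=
  ∃ h : F ≤ L, ∀ c ∈ L, ∀ p : Polynomial F, IsMinPolyOf F c p → SplitsIn h p

/-- `K` is a (commutative) subfield of the subring `A`. -/
def IsSubfieldOf {R : Type*} [Ring R] (A K : Subring R) : Prop :=
  K ≤ A ∧ (∀ x ∈ K, ∀ y ∈ K, x * y = y * x) ∧
    ∀ x ∈ K, x ≠ 0 → ∃ y ∈ K, x * y = 1 ∧ y * x = 1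

/-- `K` is a maximal subfield of the subring `A`. -/
def IsMaxSubfieldOf {R : Type*} [Ring R] (A K : Subring R) : Prop :=
  IsSubfieldOf A K ∧ ∀ K' : Subring R, IsSubfieldOf A K' → K ≤ K' → K' = K

/-- `T` is a maximal graded subfield of the graded subring `A`. -/
def IsMaxGradedSubfieldOf (𝒜 : Γ → AddSubgroup D) [GradedRing 𝒜] (A T : Subring D) : Prop :=
  IsGradedSubfield 𝒜 T ∧ T ≤ A ∧
    ∀ T' : Subring D, IsGradedSubfield 𝒜 T' → T' ≤ A → T ≤ T' → T' = T

/-- The canonical subalgebra `𝖴 = 𝖣₀ ⊗_{𝖥₀} 𝖥`: the subring generated by `𝖣₀` and `𝖥`. -/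
def Uc (𝒜 : Γ → AddSubgroup D) [GradedRing 𝒜] (F : Subring D) : Subring D :=
  grade0 𝒜 ⊔ F

/-- The canonical subalgebra `𝖹 = Z(𝖣₀) ⊗_{𝖥₀} 𝖥`: the subring generated by the center
of `𝖣₀` and `𝖥`. -/
def Zc (𝒜 : Γ → AddSubgroup D) [GradedRing 𝒜] (F : Subring D) : Subring D :=
  (Subring.centralizer (grade0 𝒜 : Set D) ⊓ grade0 𝒜) ⊔ F

/-- The canonical subalgebra `𝖢 = C_𝖣(𝖴)`. -/
def Cc (𝒜 : Γ → AddSubgroup D) [GradedRing 𝒜] (F : Subring D) : Subring D :=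
  Subring.centralizer (Uc 𝒜 F : Set D)

/-- The canonical subalgebra `𝖤 = C_𝖣(𝖹)`. -/
def Ec (𝒜 : Γ → AddSubgroup D) [GradedRing 𝒜] (F : Subring D) : Subring D :=
  Subring.centralizer (Zc 𝒜 F : Set D)

end GradedDivPaper

namespace GradedDivPaper

theorem not_forall_pow_succ_le (n d : ℕ) :
    ¬ ∀ k : ℕ, (n + 1) ^ k ≤ n ^ k * (k + 1) ^ d := by
  intro h
  rcases Nat.eq_zero_or_pos n with rfl | hn
  · simpa using h 1
  have hn' : (0 : ℝ) < n := by exact_mod_cast hn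
  set r : ℝ := (n + 1) / n with hr
  have hr1 : 1 < r := by rw [hr, lt_div_iff₀ hn']; linarith
  have hr0 : 0 < r := one_pos.trans hr1
  have ht := (Filter.tendsto_add_atTop_iff_nat 1).2
    (tendsto_pow_const_div_const_pow_of_one_lt d hr1)
  obtain ⟨k, hk⟩ := (ht.eventually (gt_mem_nhds (inv_pos.2 hr0))).exists
  have h1 : ((n : ℝ) + 1) ^ k ≤ n ^ k * ((k : ℝ) + 1) ^ d := by exact_mod_cast h k
  have h2 : r ^ k ≤ ((k : ℝ) + 1) ^ d := by
    rw [hr, div_pow, div_le_iff₀ (pow_pos hn' k)]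
    linarith
  rw [div_lt_iff₀ (pow_pos hr0 _), pow_succ, mul_comm (r ^ k) r, inv_mul_cancel_left₀ hr0.ne']
    at hk
  push_cast at hk
  exact absurd h2 (not_le.2 hk)

/-- If any finite set of ring elements can be absorbed by a chain of subspaces of polynomially
bounded dimension, then the ring satisfies the strong rank condition. -/
theorem strongRankCondition_of_polynomial_growth {K R : Type*} [DivisionRing K] [Ring R]
    [Module K R] [IsScalarTower K R R]
    (h : ∀ F : Finset R, ∃ (d : ℕ) (V : ℕ → Submodule K R), V 0 ≠ ⊥ ∧
      (∀ k, Module.Finite K (V k) ∧ Module.finrank K (V k) ≤ (k + 1) ^ d) ∧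
      ∀ k, ∀ x ∈ V k, ∀ y ∈ F, x * y ∈ V (k + 1)) : StrongRankCondition R := by
  classical
  rw [strongRankCondition_iff_succ]
  intro n f hf
  obtain ⟨d, V, hV0, hV, hmul⟩ := h
    (Finset.univ.image fun p : Fin (n + 1) × Fin n => f (Pi.single p.1 1) p.2)
  have hfin : ∀ k, Module.Finite K (V k) := fun k => (hV k).1
  have hfV : ∀ (k : ℕ) (v : Fin (n + 1) → R), (∀ i, v i ∈ V k) → ∀ j, f v j ∈ V (k + 1) := by
    intro k v hv j
    have hv' : v = ∑ i, v i • (Pi.single i 1 : Fin (n + 1) → R) := by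
      ext i
      simp [Finset.sum_apply, Pi.single_apply]
    rw [hv', map_sum, Finset.sum_apply]
    refine Submodule.sum_mem _ fun i _ => ?_
    rw [map_smul, Pi.smul_apply, smul_eq_mul]
    exact hmul k _ (hv i) _ (Finset.mem_image.2 ⟨(i, j), Finset.mem_univ _, rfl⟩)
  have hstep : ∀ k, (n + 1) * Module.finrank K (V k) ≤ n * Module.finrank K (V (k + 1)) := by
    intro k
    let g : (Fin (n + 1) → V k) →ₗ[K] (Fin n → V (k + 1)) := LinearMap.pi fun j =>
      LinearMap.codRestrict (V (k + 1))
        (LinearMap.proj j ∘ₗ f.restrictScalars K ∘ₗ (V k).subtype.compLeft (Fin (n + 1)))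
        fun v => hfV k _ (fun i => (v i).2) j
    have hg : Function.Injective g := by
      intro v w hvw
      have : (fun i => (v i : R)) = fun i => (w i : R) := by
        apply hf
        ext j
        exact congrArg Subtype.val (congrFun hvw j)
      ext i
      exact congrFun this i
    simpa [Module.finrank_pi_fintype] using LinearMap.finrank_le_finrank_of_injective hg
  have h0 : 1 ≤ Module.finrank K (V 0) := by
    rw [Nat.one_le_iff_ne_zero, Ne, Submodule.finrank_eq_zero]
    exact hV0
  have hpow : ∀ k, (n + 1) ^ k ≤ n ^ k * Module.finrank K (V k) := by
    intro k
    induction k with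
    | zero => simpa using h0
    | succ k ih =>
      calc (n + 1) ^ (k + 1) = (n + 1) ^ k * (n + 1) := pow_succ _ _
        _ ≤ n ^ k * Module.finrank K (V k) * (n + 1) := Nat.mul_le_mul_right _ ih
        _ = n ^ k * ((n + 1) * Module.finrank K (V k)) := by ring
        _ ≤ n ^ k * (n * Module.finrank K (V (k + 1))) := Nat.mul_le_mul_left _ (hstep k)
        _ = n ^ (k + 1) * Module.finrank K (V (k + 1)) := by ring
  exact not_forall_pow_succ_le n d fun k =>
    (hpow k).trans (Nat.mul_le_mul_left _ (hV k).2)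

/-- Twisted group rings of abelian groups over division rings, and their homomorphic images,
satisfy the strong rank condition. -/
theorem strongRankCondition_of_twisted {Γ K R : Type*} [AddCommGroup Γ] [DivisionRing K] [Ring R]
    [Module K R] [IsScalarTower K R R] (u : Γ → R) (h0 : u 0 ≠ 0)
    (hu : Submodule.span K (Set.range u) = ⊤)
    (hmul : ∀ γ δ (c : K), u γ * c • u δ ∈ Submodule.span K {u (γ + δ)}) :
    StrongRankCondition R := by
  classical
  refine strongRankCondition_of_polynomial_growth (K := K) fun F => ?_
  have hrep : ∀ y : R, ∃ c : Γ →₀ K, c.sum (fun γ a => a • u γ) = y := fun y =>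
    Finsupp.mem_span_range_iff_exists_finsupp.1 (hu ▸ Submodule.mem_top)
  choose c hc using hrep
  let S : Finset Γ := F.biUnion fun y => (c y).support
  let w : ∀ k : ℕ, (S → Fin (k + 1)) → R := fun k φ => u (∑ s, (φ s : ℕ) • (s : Γ))
  refine ⟨S.card, fun k => Submodule.span K (Set.range (w k)), ?_, fun k => ⟨?_, ?_⟩, ?_⟩
  · intro hbot
    have : w 0 0 ∈ Submodule.span K (Set.range (w 0)) := Submodule.subset_span ⟨_, rfl⟩
    rw [show Submodule.span K (Set.range (w 0)) = ⊥ from hbot, Submodule.mem_bot] at this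
    exact h0 (by simpa [w] using this)
  · exact Module.Finite.span_of_finite K (Set.finite_range _)
  · refine (finrank_range_le_card (R := K) (w k)).trans ?_
    simp
  · intro k x hx y hy
    induction hx using Submodule.span_induction with
    | zero => simp
    | add a b _ _ ha hb => rw [add_mul]; exact Submodule.add_mem _ ha hb
    | smul a b _ hb => rw [smul_mul_assoc]; exact Submodule.smul_mem _ _ hb
    | mem x hx =>
      obtain ⟨φ, rfl⟩ := hx
      rw [← hc y, Finsupp.sum, Finset.mul_sum]
      refine Submodule.sum_mem _ fun γ hγ => ?_
      refine Submodule.span_mono ?_ (hmul _ γ _)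
      rw [Set.singleton_subset_iff]
      let s₀ : S := ⟨γ, Finset.mem_biUnion.2 ⟨y, hy, hγ⟩⟩
      refine ⟨fun s => ⟨(φ s : ℕ) + if s = s₀ then 1 else 0, ?_⟩, ?_⟩
      · have := (φ s).2
        split_ifs <;> omega
      · simp [w, add_smul, Finset.sum_add_distrib, ite_smul, s₀]

section Graded

variable {Γ : Type*} [AddCommGroup Γ] [DecidableEq Γ] {D : Type*} [Ring D]
  {𝒜 : Γ → AddSubgroup D} [GradedRing 𝒜] {E : Subring D}

theorem mem_neg_of_mul_eq_one {γ : Γ} {x y : D} (hx : x ∈ 𝒜 γ) (hxy : x * y = 1)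
    (hyx : y * x = 1) : y ∈ 𝒜 (-γ) := by
  have h := DirectSum.coe_decompose_mul_add_of_left_mem 𝒜 (j := -γ) (b := y) hx
  rw [hxy, add_neg_cancel, DirectSum.decompose_of_mem_same 𝒜 (SetLike.one_mem_graded 𝒜)] at h
  have : y = DirectSum.decompose 𝒜 y (-γ) := by
    calc y = y * 1 := (mul_one y).symm
      _ = _ := by rw [h, ← mul_assoc, hyx, one_mul]
  rw [this]
  exact SetLike.coe_mem _

theorem IsGradedDivisionRing.isGradedDivSubring_top (hD : IsGradedDivisionRing 𝒜) :
    IsGradedDivSubring 𝒜 (⊤ : Subring D) := by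
  refine ⟨fun _ _ _ => Subring.mem_top _, fun γ x _ hx hx0 => ?_⟩
  obtain ⟨u, rfl⟩ := hD.2 γ x hx hx0
  exact ⟨_, Subring.mem_top _, u.mul_inv, u.inv_mul⟩

theorem IsGradedDivSubring.exists_inv (hE : IsGradedDivSubring 𝒜 E) {γ : Γ} {x : D}
    (hxE : x ∈ E) (hx : x ∈ 𝒜 γ) (hx0 : x ≠ 0) :
    ∃ y ∈ E, y ∈ 𝒜 (-γ) ∧ x * y = 1 ∧ y * x = 1 := by
  obtain ⟨y, hy, hxy, hyx⟩ := hE.2 γ x hxE hx hx0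
  exact ⟨y, hy, mem_neg_of_mul_eq_one hx hxy hyx, hxy, hyx⟩

theorem zero_mem_gradeSet [Nontrivial D] : (0 : Γ) ∈ gradeSet 𝒜 E :=
  ⟨1, E.one_mem, SetLike.one_mem_graded 𝒜, one_ne_zero⟩

theorem IsGradedDivSubring.neg_mem_gradeSet [Nontrivial D] (hE : IsGradedDivSubring 𝒜 E) {γ : Γ}
    (h : γ ∈ gradeSet 𝒜 E) : -γ ∈ gradeSet 𝒜 E := by
  obtain ⟨x, hxE, hx, hx0⟩ := h
  obtain ⟨y, hyE, hy, hxy, -⟩ := hE.exists_inv hxE hx hx0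
  exact ⟨y, hyE, hy, right_ne_zero_of_mul_eq_one hxy⟩

theorem IsGradedDivSubring.add_mem_gradeSet (hE : IsGradedDivSubring 𝒜 E) {γ δ : Γ}
    (h : γ ∈ gradeSet 𝒜 E) (h' : δ ∈ gradeSet 𝒜 E) : γ + δ ∈ gradeSet 𝒜 E := by
  obtain ⟨x, hxE, hx, hx0⟩ := h
  obtain ⟨x', hxE', hx', hx0'⟩ := h'
  obtain ⟨y, hyE, hy, -, hyx⟩ := hE.exists_inv hxE hx hx0
  refine ⟨x * x', E.mul_mem hxE hxE', SetLike.mul_mem_graded hx hx', fun h => hx0' ?_⟩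
  rw [← one_mul x', ← hyx, mul_assoc, h, mul_zero]

theorem IsGradedDivSubring.equivalence_sub_mem [Nontrivial D] (hE : IsGradedDivSubring 𝒜 E)
    (A : Set Γ) : Equivalence (fun x y : A => (x : Γ) - (y : Γ) ∈ gradeSet 𝒜 E) where
  refl x := by simpa using zero_mem_gradeSet
  symm h := by simpa using hE.neg_mem_gradeSet h
  trans h h' := by simpa using hE.add_mem_gradeSet h h'

/-- The degree-zero part of a graded division subring is a division ring. -/
theorem IsGradedDivSubring.isUnit_or_eq_zero (hE : IsGradedDivSubring 𝒜 E)
    (a : (grade0 𝒜).comap E.subtype) : IsUnit a ∨ a = 0 := by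
  by_cases ha : ((a : E) : D) = 0
  · exact Or.inr (Subtype.ext (Subtype.ext ha))
  · obtain ⟨y, hyE, hy, hxy, hyx⟩ := hE.exists_inv (γ := 0) (a : E).2 a.2 ha
    rw [neg_zero] at hy
    exact Or.inl ⟨⟨a, ⟨⟨y, hyE⟩, hy⟩, Subtype.ext (Subtype.ext hxy),
      Subtype.ext (Subtype.ext hyx)⟩, rfl⟩

theorem IsGradedDivSubring.isUnit_or_eq_zero_inf (hE : IsGradedDivSubring 𝒜 E)
    (a : (E ⊓ grade0 𝒜).comap (grade0 𝒜).subtype) : IsUnit a ∨ a = 0 := by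
  by_cases ha : ((a : grade0 𝒜) : D) = 0
  · exact Or.inr (Subtype.ext (Subtype.ext ha))
  · obtain ⟨y, hyE, hy, hxy, hyx⟩ := hE.exists_inv (γ := 0) a.2.1 a.2.2 ha
    rw [neg_zero] at hy
    exact Or.inl ⟨⟨a, ⟨⟨y, hy⟩, ⟨hyE, hy⟩⟩, Subtype.ext (Subtype.ext hxy),
      Subtype.ext (Subtype.ext hyx)⟩, rfl⟩

/-- A graded division ring satisfies the strong rank condition. -/
theorem IsGradedDivSubring.strongRankCondition [Nontrivial D] (hE : IsGradedDivSubring 𝒜 E) :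
    StrongRankCondition E := by
  classical
  let K : Subring E := (grade0 𝒜).comap E.subtype
  let : DivisionRing K := DivisionRing.ofIsUnitOrEqZero hE.isUnit_or_eq_zero
  have hex : ∀ γ : Γ, ∃ x : E, (x : D) ∈ 𝒜 γ ∧ (γ ∈ gradeSet 𝒜 E → x ≠ 0) := by
    intro γ
    by_cases hγ : γ ∈ gradeSet 𝒜 E
    · obtain ⟨x, hxE, hx, hx0⟩ := hγ
      exact ⟨⟨x, hxE⟩, hx, fun _ h => hx0 (congrArg Subtype.val h)⟩
    · exact ⟨0, (𝒜 γ).zero_mem, fun h => absurd h hγ⟩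
  choose u hu hu0 using hex
  have hspan : ∀ (γ : Γ) (x : E), (x : D) ∈ 𝒜 γ → x ∈ Submodule.span K {u γ} := by
    intro γ x hx
    by_cases hx0 : x = 0
    · rw [hx0]; exact Submodule.zero_mem _
    have hγ : γ ∈ gradeSet 𝒜 E := ⟨x, x.2, hx, fun h => hx0 (Subtype.ext h)⟩
    obtain ⟨y, hyE, hy, -, hyx⟩ := hE.exists_inv (u γ).2 (hu γ)
      fun h => hu0 γ hγ (Subtype.ext h)
    have hc : (x : D) * y ∈ 𝒜 0 := by simpa using SetLike.mul_mem_graded hx hy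
    refine Submodule.mem_span_singleton.2 ⟨⟨x * ⟨y, hyE⟩, hc⟩, Subtype.ext ?_⟩
    change (x : D) * y * u γ = x
    rw [mul_assoc, hyx, mul_one]
  refine strongRankCondition_of_twisted (K := K) u (hu0 0 zero_mem_gradeSet) ?_ ?_
  · rw [eq_top_iff]
    intro x _
    have hx : x = ∑ γ ∈ (DirectSum.decompose 𝒜 (x : D)).support,
        (⟨DirectSum.decompose 𝒜 (x : D) γ, hE.1 x x.2 γ⟩ : E) := by
      apply Subtype.ext
      rw [AddSubmonoidClass.coe_finsetSum]
      exact (DirectSum.sum_support_decompose 𝒜 (x : D)).symm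
    rw [hx]
    refine Submodule.sum_mem _ fun γ _ => ?_
    exact Submodule.span_mono (Set.singleton_subset_iff.2 (Set.mem_range_self γ))
      (hspan γ _ (SetLike.coe_mem (DirectSum.decompose 𝒜 (x : D) γ)))
  · intro γ δ c
    refine hspan _ _ (SetLike.mul_mem_graded (hu γ) ?_)
    have := SetLike.mul_mem_graded (A := 𝒜) c.2 (hu δ)
    rwa [zero_add] at this

section Basis

variable {ι Q : Type*} {b : ι → grade0 𝒜} {θ : Q → Γ} {a : Q → D}

theorem linearIndependent_mul (hE : IsGradedDivSubring 𝒜 E)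
    (hD : IsGradedDivisionRing 𝒜)
    (hb : LinearIndependent ((E ⊓ grade0 𝒜).comap (grade0 𝒜).subtype) b)
    (ha : ∀ q, a q ∈ 𝒜 (θ q)) (ha0 : ∀ q, a q ≠ 0)
    (hθ : ∀ q q', θ q - θ q' ∈ gradeSet 𝒜 E → q = q') :
    LinearIndependent E fun p : ι × Q => (b p.1 : D) * a p.2 := by
  classical
  have : Nontrivial D := ⟨0, 1, hD.1⟩
  rw [linearIndependent_iff']
  rintro s g hg ⟨i₀, q₀⟩ hp
  by_contra hne
  obtain ⟨δ, hδ⟩ : ∃ δ, (DirectSum.decompose 𝒜 (g (i₀, q₀) : D) δ : D) ≠ 0 := by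
    by_contra! hall
    apply hne
    apply Subtype.ext
    rw [← DirectSum.sum_support_decompose 𝒜 (g (i₀, q₀) : D)]
    exact Finset.sum_eq_zero fun γ _ => hall γ
  let e : D := (DirectSum.decompose 𝒜 (g (i₀, q₀) : D) δ : D)
  have heE : e ∈ E := hE.1 _ (g _).2 δ
  have heδ : e ∈ 𝒜 δ := SetLike.coe_mem _
  obtain ⟨e', heE', heδ', -, hee⟩ := hE.exists_inv heE heδ hδ
  obtain ⟨a', -, -, haa, -⟩ := hD.isGradedDivSubring_top.exists_inv
    (Subring.mem_top _) (ha q₀) (ha0 q₀)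
  have hcomp : ∑ p ∈ s with p.2 = q₀,
      (DirectSum.decompose 𝒜 (g p : D) δ : D) * (b p.1 * a q₀) = 0 := by
    have h1 := congrArg (fun x : D => (DirectSum.decompose 𝒜 x (δ + θ q₀) : D)) hg
    simp only [DirectSum.decompose_sum, DirectSum.sum_apply, AddSubmonoidClass.coe_finsetSum,
      DirectSum.decompose_zero, DirectSum.zero_apply, ZeroMemClass.coe_zero] at h1
    rw [← h1, Finset.sum_filter]
    refine Finset.sum_congr rfl fun p _ => ?_
    have hba : (b p.1 : D) * a p.2 ∈ 𝒜 (θ p.2) := by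
      simpa using SetLike.mul_mem_graded (A := 𝒜) (b p.1).2 (ha p.2)
    have hdeg : δ + θ q₀ = (δ + θ q₀ - θ p.2) + θ p.2 := by abel
    rw [Subring.smul_def, smul_eq_mul, hdeg,
      DirectSum.coe_decompose_mul_add_of_right_mem 𝒜 hba]
    split_ifs with hq
    · rw [hq, add_sub_cancel_right]
    · by_contra hz
      have hmem : δ + θ q₀ - θ p.2 ∈ gradeSet 𝒜 E :=
        ⟨_, hE.1 _ (g p).2 _, SetLike.coe_mem _, left_ne_zero_of_mul (Ne.symm hz)⟩
      refine hq (hθ _ _ ?_).symm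
      have := hE.add_mem_gradeSet hmem (hE.neg_mem_gradeSet ⟨e, heE, heδ, hδ⟩)
      convert this using 1
      abel
  have hcE : ∀ p, e' * (DirectSum.decompose 𝒜 (g p : D) δ : D) ∈ E := fun p =>
    E.mul_mem heE' (hE.1 _ (g p).2 δ)
  have hc0 : ∀ p, e' * (DirectSum.decompose 𝒜 (g p : D) δ : D) ∈ grade0 𝒜 := fun p => by
    have := SetLike.mul_mem_graded (A := 𝒜) heδ'
      (SetLike.coe_mem (DirectSum.decompose 𝒜 (g p : D) δ))
    rwa [neg_add_cancel] at this
  have hinj : Function.Injective (fun p : {p : ι × Q // p.2 = q₀} => p.1.1) := by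
    intro p p' h
    exact Subtype.ext (Prod.ext h (p.2.trans p'.2.symm))
  have hli := linearIndependent_iff'.1 (hb.comp _ hinj) (s.subtype fun p => p.2 = q₀)
    (fun p => ⟨⟨_, hc0 p.1⟩, ⟨hcE p.1, hc0 p.1⟩⟩) ?_ ⟨(i₀, q₀), rfl⟩ (by simpa using hp)
  · have h1 : e' * e = 0 := congrArg (Subtype.val ∘ Subtype.val) hli
    exact hD.1 (h1.symm.trans hee)
  · apply Subtype.ext
    rw [AddSubmonoidClass.coe_finsetSum]
    have h2 : ∑ p ∈ s with p.2 = q₀,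
        e' * (DirectSum.decompose 𝒜 (g p : D) δ : D) * b p.1 = 0 := by
      have h3 := congrArg (fun x => e' * x * a') hcomp
      simp only [Finset.mul_sum, Finset.sum_mul, mul_zero, zero_mul] at h3
      rw [← h3]
      refine Finset.sum_congr rfl fun p _ => ?_
      simp only [mul_assoc, haa, mul_one]
    rw [← Finset.sum_subtype_eq_sum_filter] at h2
    exact h2

theorem span_range_mul_eq_top (hE : IsGradedDivSubring 𝒜 E)
    (hD : IsGradedDivisionRing 𝒜)
    (hb : Submodule.span ((E ⊓ grade0 𝒜).comap (grade0 𝒜).subtype) (Set.range b) = ⊤)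
    (ha : ∀ q, a q ∈ 𝒜 (θ q)) (ha0 : ∀ q, a q ≠ 0)
    (hθ : ∀ γ ∈ gradeSet 𝒜 (⊤ : Subring D), ∃ q, γ - θ q ∈ gradeSet 𝒜 E) :
    Submodule.span E (Set.range fun p : ι × Q => (b p.1 : D) * a p.2) = ⊤ := by
  classical
  let W := Submodule.span E (Set.range fun p : ι × Q => (b p.1 : D) * a p.2)
  have hzero : ∀ (q : Q) (x : grade0 𝒜), (x : D) * a q ∈ W := by
    intro q x
    have hx : x ∈ Submodule.span ((E ⊓ grade0 𝒜).comap (grade0 𝒜).subtype) (Set.range b) :=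
      hb ▸ Submodule.mem_top
    induction hx using Submodule.span_induction with
    | zero => simp
    | add x y _ _ hx hy =>
      rw [Subring.coe_add, add_mul]
      exact W.add_mem hx hy
    | smul c x _ hx =>
      have := W.smul_mem ⟨((c : grade0 𝒜) : D), c.2.1⟩ hx
      rw [Subring.smul_def, smul_eq_mul, ← mul_assoc] at this
      exact this
    | mem x hx =>
      obtain ⟨i, rfl⟩ := hx
      exact Submodule.subset_span ⟨(i, q), rfl⟩
  have hhom : ∀ (γ : Γ) (x : D), x ∈ 𝒜 γ → x ∈ W := by
    intro γ x hx
    by_cases hx0 : x = 0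
    · rw [hx0]; exact W.zero_mem
    obtain ⟨q, e, heE, he, he0⟩ := hθ γ ⟨x, Subring.mem_top _, hx, hx0⟩
    obtain ⟨e', -, he', hee, -⟩ := hE.exists_inv heE he he0
    obtain ⟨a', -, ha', -, haa⟩ := hD.isGradedDivSubring_top.exists_inv
      (Subring.mem_top _) (ha q) (ha0 q)
    have hy : e' * x * a' ∈ grade0 𝒜 := by
      have := SetLike.mul_mem_graded (SetLike.mul_mem_graded he' hx) ha'
      have hdeg : -(γ - θ q) + γ + -θ q = 0 := by abel
      rwa [hdeg] at this
    have := W.smul_mem ⟨e, heE⟩ (hzero q ⟨_, hy⟩)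
    rw [Subring.smul_def, smul_eq_mul] at this
    have hx' : e * (e' * x * a' * a q) = x := by
      rw [mul_assoc (e' * x), haa, mul_one, ← mul_assoc, hee, one_mul]
    rwa [hx'] at this
  rw [eq_top_iff]
  intro x _
  rw [← DirectSum.sum_support_decompose 𝒜 x]
  exact W.sum_mem fun γ _ => hhom γ _ (SetLike.coe_mem _)

end Basis

end Graded

/-- fundamental equality:
For a graded division ring `D` and a graded division subring `E`,
`[D : E] = [D₀ : E₀] ⬝ |Γ_D : Γ_E|`. -/
theorem stmt_1 {Γ : Type*} [AddCommGroup Γ] [DecidableEq Γ] {D : Type*} [Ring D]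
    (hΓ : TorsionFree Γ) (𝒜 : Γ → AddSubgroup D) [GradedRing 𝒜]
    (hD : IsGradedDivisionRing 𝒜)
    (E : Subring D) (hE : IsGradedDivSubring 𝒜 E)
    (hfin : finiteOver E) :
    dimOver E =
      relDim (E ⊓ grade0 𝒜) (grade0 𝒜) * addSetIndex (gradeSet 𝒜 ⊤) (gradeSet 𝒜 E) := by
  have : Nontrivial D := ⟨0, 1, hD.1⟩
  have := hE.strongRankCondition
  let K : Subring (grade0 𝒜) := (E ⊓ grade0 𝒜).comap (grade0 𝒜).subtype
  let : DivisionRing K := DivisionRing.ofIsUnitOrEqZero hE.isUnit_or_eq_zero_inf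
  let b := Module.Basis.ofVectorSpace K (grade0 𝒜)
  let r := fun x y : gradeSet 𝒜 (⊤ : Subring D) => (x : Γ) - (y : Γ) ∈ gradeSet 𝒜 E
  have hr : Equivalence r := hE.equivalence_sub_mem _
  let θ : Quot r → Γ := fun q => q.out
  choose a _ ha ha0 using fun q : Quot r => q.out.2
  have hli := linearIndependent_mul (θ := θ) hE hD b.linearIndependent ha ha0 fun q q' h => by
    rw [← Quot.out_eq q, ← Quot.out_eq q']
    exact Quot.sound h
  have hsp := span_range_mul_eq_top (θ := θ) hE hD b.span_eq ha ha0 fun γ hγ =>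
    ⟨Quot.mk r ⟨γ, hγ⟩, (hr.quot_mk_eq_iff ⟨γ, hγ⟩ _).1 (Quot.out_eq (Quot.mk r ⟨γ, hγ⟩)).symm⟩
  rw [dimOver, relDim, addSetIndex,
    Module.finrank_eq_nat_card_basis (Module.Basis.mk hli hsp.ge), Nat.card_prod]
  exact congrArg (· * Nat.card (Quot r)) (Module.finrank_eq_nat_card_basis b).symm

end GradedDivPaper
end
end

section
/- Let \(\mathsf{D}\) be a finite-dimensional graded division algebra over a graded field \(\mathsf{F}\subseteq Z(\mathsf{D})\), and let \(\mathsf{K}\) and \(\mathsf{L}\) be graded subfields of \(\mathsf{D}\) containing \(\mathsf{F}\) that commute elementwise, with \(\mathsf{L}\) Galois over \(\mathsf{K}\cap\mathsf{L}\). Then \(\mathsf{K}\) and \(\mathsf{L}\) are linearly disjoint over \(\mathsf{K}\cap\mathsf{L}\); equivalently, \([\mathsf{K}\cdot\mathsf{L}:\mathsf{K}\cap\mathsf{L}] = [\mathsf{K}:\mathsf{K}\cap\mathsf{L}]\cdot[\mathsf{L}:\mathsf{K}\cap\mathsf{L}]\). -/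
noncomputable section

namespace GradedDivPaper

open scoped nonZeroDivisors TensorProduct

/-- A torsion-free abelian group has unique sums, since it embeds into a `ℚ`-vector space. -/
theorem TorsionFree.twoUniqueSums {Γ : Type*} [AddCommGroup Γ] (hΓ : TorsionFree Γ) :
    TwoUniqueSums Γ := by
  have : IsAddTorsionFree Γ := ⟨fun n hn x y hxy => by
    exact sub_eq_zero.mp (hΓ (x - y) n hn (by rw [nsmul_sub, sub_eq_zero]; exact hxy))⟩
  let f : Γ →ₗ[ℤ] ℚ ⊗[ℤ] Γ :=
    (LinearMap.rTensor Γ (Algebra.linearMap ℤ ℚ)) ∘ₗ (TensorProduct.lid ℤ Γ).symm.toLinearMap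
  have hf : Function.Injective f := by
    refine (Module.Flat.rTensor_preserves_injective_linearMap _ ?_).comp
      (TensorProduct.lid ℤ Γ).symm.injective
    exact (algebraMap ℤ ℚ).injective_int
  exact TwoUniqueSums.of_injective_addHom f.toAddMonoidHom.toAddHom hf inferInstance

/-- A graded division ring graded by a torsion-free abelian group is a domain. -/
theorem IsGradedDivisionRing.isDomain {Γ : Type*} [AddCommGroup Γ] [DecidableEq Γ]
    {D : Type*} [Ring D] (hΓ : TorsionFree Γ) (𝒜 : Γ → AddSubgroup D) [GradedRing 𝒜]
    (hD : IsGradedDivisionRing 𝒜) : IsDomain D := by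
  classical
  have : TwoUniqueSums Γ := hΓ.twoUniqueSums
  have : Nontrivial D := ⟨0, 1, hD.1⟩
  have : NoZeroDivisors D := ⟨fun {x y} hxy => by
    by_contra! h
    obtain ⟨hx, hy⟩ := h
    have ne (z : D) (hz : z ≠ 0) : (DirectSum.decompose 𝒜 z).support.Nonempty := by
      rw [Finset.nonempty_iff_ne_empty, Ne, DFinsupp.support_eq_empty]
      exact fun h => hz ((DirectSum.decompose 𝒜).injective
        (h.trans (DirectSum.decompose_zero 𝒜).symm))
    obtain ⟨a, ha, b, hb, hab⟩ := UniqueSums.uniqueAdd_of_nonempty (ne x hx) (ne y hy)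
    have key : (DirectSum.decompose 𝒜 (x * y) (a + b) : D) =
        DirectSum.decompose 𝒜 x a * DirectSum.decompose 𝒜 y b := by
      rw [DirectSum.decompose_mul, DirectSum.coe_mul_apply, Finset.sum_eq_single (a, b)]
      · rintro ⟨c, d⟩ hcd hne
        simp only [Finset.mem_filter, Finset.mem_product] at hcd
        obtain ⟨rfl, rfl⟩ := hab hcd.1.1 hcd.1.2 hcd.2
        exact absurd rfl hne
      · intro h
        simp [ha, hb] at h
    rw [hxy, DirectSum.decompose_zero] at key
    have hu : IsUnit (DirectSum.decompose 𝒜 x a : D) :=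
      hD.2 a _ (SetLike.coe_mem _) (by simpa using ha)
    have hv : IsUnit (DirectSum.decompose 𝒜 y b : D) :=
      hD.2 b _ (SetLike.coe_mem _) (by simpa using hb)
    exact (hu.mul hv).ne_zero (by simpa using key.symm)⟩
  exact NoZeroDivisors.to_isDomain D

/-- If the domain `S` is algebraic over `R`, then every element of the fraction field of `S` can be
written with a denominator in `R`. -/
theorem exists_smul_eq_algebraMap {R S S' : Type*} [CommRing R] [IsDomain R] [CommRing S]
    [IsDomain S] [Algebra R S] [FaithfulSMul R S] [Algebra.IsAlgebraic R S] [Field S']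
    [Algebra R S'] [Algebra S S'] [IsScalarTower R S S'] [IsFractionRing S S'] (z : S') :
    ∃ r : R, r ≠ 0 ∧ ∃ s : S, algebraMap R S' r * z = algebraMap S S' s := by
  obtain ⟨⟨s, ⟨_, r, hr, rfl⟩⟩, h⟩ :=
    IsLocalization.surj (Algebra.algebraMapSubmonoid S R⁰) z
  refine ⟨r, nonZeroDivisors.ne_zero hr, s, ?_⟩
  rw [← h, mul_comm, IsScalarTower.algebraMap_apply R S S']

theorem isAlgebraic_of_finrank_ne_zero {R S : Type*} [CommRing R] [IsDomain R] [CommRing S]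
    [IsDomain S] [Algebra R S] [FaithfulSMul R S] (h : Module.finrank R S ≠ 0) :
    Algebra.IsAlgebraic R S := by
  let := FractionRing.liftAlgebra R (FractionRing S)
  have : Module.Finite (FractionRing R) (FractionRing S) := by
    apply Module.finite_of_finrank_pos
    rw [IsFractionRing.finrank_eq R _ S]
    exact Nat.pos_of_ne_zero h
  rw [IsFractionRing.isAlgebraic_iff' R S (FractionRing S),
    IsFractionRing.comap_isAlgebraic_iff (K := FractionRing R)]
  infer_instance

theorem finrank_eq_zero_of_injective {R M N : Type*} [CommRing R] [IsDomain R] [AddCommGroup M]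
    [AddCommGroup N] [Module R M] [Module R N] [Module.IsTorsionFree R M] [Nontrivial M]
    (f : M →ₗ[R] N) (hf : Function.Injective f) (h : Module.finrank R M = 0) :
    Module.finrank R N = 0 := by
  have hle := LinearMap.lift_rank_le_of_injective f hf
  have hpos : 0 < Module.rank R M := rank_pos
  rw [Module.finrank, Cardinal.toNat_eq_zero] at h ⊢
  exact .inr (Cardinal.aleph0_le_lift.mp ((Cardinal.aleph0_le_lift.mpr
    (h.resolve_left hpos.ne')).trans hle))

theorem fieldRange_sup_eq_top_of_isFractionRing {R A B C k M P Q : Type*} [CommRing R]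
    [CommRing A] [CommRing B] [CommRing C] [Algebra R A] [Algebra R B] [Algebra R C] [Field k]
    [Field M] [Field P] [Field Q] [Algebra R k] [Algebra A M] [IsFractionRing A M] [Algebra R M]
    [Algebra k M] [IsScalarTower R A M] [IsScalarTower R k M] [Algebra B P] [Algebra k P]
    [Algebra C Q] [Algebra k Q] {f : B →ₐ[R] A} {g : C →ₐ[R] A}
    (hsup : f.range ⊔ g.range = ⊤) (i : P →ₐ[k] M) (j : Q →ₐ[k] M)
    (hi : ∀ b, i (algebraMap B P b) = algebraMap A M (f b))
    (hj : ∀ c, j (algebraMap C Q c) = algebraMap A M (g c)) :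
    i.fieldRange ⊔ j.fieldRange = ⊤ := by
  rw [eq_top_iff]
  have hA (a : A) : algebraMap A M a ∈ i.fieldRange ⊔ j.fieldRange := by
    let T : Subalgebra R A :=
      ((i.fieldRange ⊔ j.fieldRange).toSubalgebra.restrictScalars R).comap
        (IsScalarTower.toAlgHom R A M)
    have hT : f.range ⊔ g.range ≤ T := by
      refine sup_le ?_ ?_
      · rintro _ ⟨x, rfl⟩
        exact (le_sup_left : i.fieldRange ≤ i.fieldRange ⊔ j.fieldRange) ⟨_, hi x⟩
      · rintro _ ⟨x, rfl⟩
        exact (le_sup_right : j.fieldRange ≤ i.fieldRange ⊔ j.fieldRange) ⟨_, hj x⟩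
    exact hT (hsup ▸ Algebra.mem_top)
  intro z _
  obtain ⟨x, y, -, rfl⟩ := IsFractionRing.div_surjective A z
  exact div_mem (hA x) (hA y)

section FractionField

variable {R A B C k M P Q : Type*} [CommRing R] [CommRing A] [CommRing B]
  [CommRing C] [Algebra R A] [Algebra R B] [Algebra R C]
  [Field k] [Field M] [Field P] [Field Q]
  [Algebra R k] [IsFractionRing R k]
  [Algebra A M] [IsFractionRing A M] [Algebra R M] [Algebra k M] [IsScalarTower R A M]
  [IsScalarTower R k M]
  [Algebra B P] [IsFractionRing B P] [Algebra R P] [Algebra k P] [IsScalarTower R B P]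
  [IsScalarTower R k P]
  [Algebra C Q] [IsFractionRing C Q] [Algebra R Q] [Algebra k Q] [IsScalarTower R C Q]
  [IsScalarTower R k Q]

variable (R B k P) in
/-- If the domain `B` is algebraic over `R` and `R` is the fixed ring of `Aut(B/R)`, then a finite
extension of their fraction fields is Galois. -/
theorem isGalois_of_isFractionRing [IsDomain R] [IsDomain B] [FaithfulSMul R B]
    [Algebra.IsAlgebraic R B] [FiniteDimensional k P]
    (hG : ∀ x : B, (∀ σ : B ≃ₐ[R] B, σ x = x) → x ∈ (⊥ : Subalgebra R B)) :
    IsGalois k P := by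
  apply IsGalois.of_fixedField_eq_bot
  rw [eq_bot_iff]
  intro z hz
  obtain ⟨r, hr, s, hs⟩ := exists_smul_eq_algebraMap (R := R) (S := B) z
  have hs' : s ∈ (⊥ : Subalgebra R B) := by
    refine hG s fun σ => IsFractionRing.injective B P ?_
    let τ := IsFractionRing.fieldEquivOfAlgEquiv k P P σ
    have hτ : τ z = z := hz ⟨τ, Subgroup.mem_top _⟩
    have hτs : τ (algebraMap B P s) = algebraMap B P (σ s) :=
      IsFractionRing.fieldEquivOfAlgEquiv_algebraMap _ _ _ σ s
    rw [← hτs, ← hs, map_mul, hτ, IsScalarTower.algebraMap_apply R k P, AlgEquiv.commutes]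
  obtain ⟨c, rfl⟩ := hs'
  have hr' : algebraMap R P r ≠ 0 := by
    rw [IsScalarTower.algebraMap_apply R k P]
    simpa using hr
  rw [IntermediateField.mem_bot]
  refine ⟨algebraMap R _ c / algebraMap R _ r, ?_⟩
  rw [map_div₀, ← IsScalarTower.algebraMap_apply, ← IsScalarTower.algebraMap_apply,
    div_eq_iff hr', mul_comm, hs]
  exact IsScalarTower.algebraMap_apply _ _ _ _

variable (k M P) in
/-- An injective map of domains over `R` induces an embedding of fraction fields. -/
theorem exists_algHom_of_isFractionRing (f : B →ₐ[R] A) (hf : Function.Injective f) :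
    ∃ j : P →ₐ[k] M, ∀ b : B, j (algebraMap B P b) = algebraMap A M (f b) := by
  have hinj : Function.Injective ((algebraMap A M).comp f.toRingHom) :=
    (IsFractionRing.injective A M).comp hf
  let g : P →+* M := IsFractionRing.lift hinj
  have hg (b : B) : g (algebraMap B P b) = algebraMap A M (f b) :=
    IsFractionRing.lift_algebraMap hinj b
  have hgR (r : R) : g (algebraMap R P r) = algebraMap R M r := by
    rw [IsScalarTower.algebraMap_apply R B P, hg, f.commutes,
      ← IsScalarTower.algebraMap_apply R A M]
  refine ⟨{ g with commutes' := fun x => ?_ }, hg⟩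
  obtain ⟨x, y, -, rfl⟩ := IsFractionRing.div_surjective R x
  change g _ = _
  simp_rw [map_div₀, ← IsScalarTower.algebraMap_apply, hgR]

theorem fieldRange_inf_eq_bot_of_isFractionRing [IsDomain R] [IsDomain B] [IsDomain C]
    [FaithfulSMul R B] [FaithfulSMul R C] [Algebra.IsAlgebraic R B] [Algebra.IsAlgebraic R C]
    {f : B →ₐ[R] A} {g : C →ₐ[R] A} (hinf : f.range ⊓ g.range = ⊥) (i : P →ₐ[k] M) (j : Q →ₐ[k] M)
    (hi : ∀ b, i (algebraMap B P b) = algebraMap A M (f b))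
    (hj : ∀ c, j (algebraMap C Q c) = algebraMap A M (g c)) :
    i.fieldRange ⊓ j.fieldRange = ⊥ := by
  rw [eq_bot_iff]
  rintro _ ⟨⟨x, rfl⟩, ⟨y, hxy⟩⟩
  replace hxy : j y = i x := hxy
  obtain ⟨r, hr, s, hs⟩ := exists_smul_eq_algebraMap (R := R) (S := B) x
  obtain ⟨t, ht, u, hu⟩ := exists_smul_eq_algebraMap (R := R) (S := C) y
  replace hs := congrArg i hs
  replace hu := congrArg j hu
  rw [map_mul, hi, IsScalarTower.algebraMap_apply R k P, AlgHom.commutes,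
    ← IsScalarTower.algebraMap_apply R k M] at hs
  rw [map_mul, hj, IsScalarTower.algebraMap_apply R k Q, AlgHom.commutes,
    ← IsScalarTower.algebraMap_apply R k M, hxy] at hu
  have hmem : t • f s = r • g u := by
    apply IsFractionRing.injective A M
    rw [Algebra.smul_def, Algebra.smul_def, map_mul, map_mul, ← hs, ← hu,
      ← IsScalarTower.algebraMap_apply, ← IsScalarTower.algebraMap_apply]
    ring
  have hbot : t • f s ∈ f.range ⊓ g.range :=
    ⟨f.range.smul_mem ⟨s, rfl⟩ t, hmem ▸ g.range.smul_mem ⟨u, rfl⟩ r⟩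
  rw [hinf] at hbot
  obtain ⟨c, hc⟩ := hbot
  replace hc : algebraMap R A c = t • f s := hc
  have hne {r : R} (hr : r ≠ 0) : algebraMap R M r ≠ 0 := by
    rw [IsScalarTower.algebraMap_apply R k M]
    simpa using hr
  refine IntermediateField.mem_bot.mpr
    ⟨algebraMap R k c / (algebraMap R k t * algebraMap R k r), ?_⟩
  rw [map_div₀, map_mul, ← IsScalarTower.algebraMap_apply, ← IsScalarTower.algebraMap_apply,
    ← IsScalarTower.algebraMap_apply, div_eq_iff (mul_ne_zero (hne ht) (hne hr)),
    IsScalarTower.algebraMap_apply R A M, hc, Algebra.smul_def, map_mul, ← hs,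
    ← IsScalarTower.algebraMap_apply]
  change _ = i x * _
  ring

theorem finrank_eq_mul_of_isFractionRing [IsDomain R] [IsDomain B] [IsDomain C]
    [FaithfulSMul R B] [FaithfulSMul R C] [Algebra.IsAlgebraic R B] [Algebra.IsAlgebraic R C]
    [FiniteDimensional k P] [FiniteDimensional k Q] {f : B →ₐ[R] A} {g : C →ₐ[R] A} (hf : Function.Injective f)
    (hg : Function.Injective g) (hsup : f.range ⊔ g.range = ⊤) (hinf : f.range ⊓ g.range = ⊥)
    (hG : ∀ x : B, (∀ σ : B ≃ₐ[R] B, σ x = x) → x ∈ (⊥ : Subalgebra R B)) :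
    Module.finrank k M = Module.finrank k P * Module.finrank k Q := by
  have := isGalois_of_isFractionRing R B k P hG
  obtain ⟨i, hi⟩ := exists_algHom_of_isFractionRing k M P f hf
  obtain ⟨j, hj⟩ := exists_algHom_of_isFractionRing k M Q g hg
  let ei := AlgEquiv.ofInjectiveField i
  let ej := AlgEquiv.ofInjectiveField j
  have : FiniteDimensional k i.fieldRange := ei.toLinearEquiv.finiteDimensional
  have : FiniteDimensional k j.fieldRange := ej.toLinearEquiv.finiteDimensional
  have : IsGalois k i.fieldRange := IsGalois.of_algEquiv ei
  have hfin := (IntermediateField.LinearDisjoint.of_inf_eq_bot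
    (fieldRange_inf_eq_bot_of_isFractionRing hinf i j hi hj)).finrank_sup
  rw [fieldRange_sup_eq_top_of_isFractionRing hsup i j hi hj,
    IntermediateField.finrank_top'] at hfin
  rw [hfin]
  exact congrArg₂ _ ei.toLinearEquiv.finrank_eq.symm ej.toLinearEquiv.finrank_eq.symm

end FractionField

/-- Linear disjointness for domains: if the images of `B` and `C` generate `A` and intersect in
`R`, and `R` is the fixed ring of `Aut(B/R)`, then ranks multiply. -/
theorem finrank_eq_finrank_mul_finrank {R A B C : Type*} [CommRing R] [IsDomain R]
    [CommRing A] [IsDomain A] [CommRing B] [IsDomain B] [CommRing C] [IsDomain C]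
    [Algebra R A] [Algebra R B] [Algebra R C] [FaithfulSMul R A] [FaithfulSMul R B]
    [FaithfulSMul R C] {f : B →ₐ[R] A} {g : C →ₐ[R] A} (hf : Function.Injective f)
    (hg : Function.Injective g) (hsup : f.range ⊔ g.range = ⊤) (hinf : f.range ⊓ g.range = ⊥)
    (hG : ∀ x : B, (∀ σ : B ≃ₐ[R] B, σ x = x) → x ∈ (⊥ : Subalgebra R B)) :
    Module.finrank R A = Module.finrank R B * Module.finrank R C := by
  by_cases hB : Module.finrank R B = 0
  · rw [hB, zero_mul, finrank_eq_zero_of_injective f.toLinearMap hf hB]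
  by_cases hC : Module.finrank R C = 0
  · rw [hC, mul_zero, finrank_eq_zero_of_injective g.toLinearMap hg hC]
  let := FractionRing.liftAlgebra R (FractionRing A)
  let := FractionRing.liftAlgebra R (FractionRing B)
  let := FractionRing.liftAlgebra R (FractionRing C)
  have := isAlgebraic_of_finrank_ne_zero hB
  have := isAlgebraic_of_finrank_ne_zero hC
  have eA : Module.finrank (FractionRing R) (FractionRing A) = Module.finrank R A :=
    IsFractionRing.finrank_eq R _ A _
  have eB : Module.finrank (FractionRing R) (FractionRing B) = Module.finrank R B :=
    IsFractionRing.finrank_eq R _ B _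
  have eC : Module.finrank (FractionRing R) (FractionRing C) = Module.finrank R C :=
    IsFractionRing.finrank_eq R _ C _
  have : FiniteDimensional (FractionRing R) (FractionRing B) :=
    Module.finite_of_finrank_pos (eB ▸ Nat.pos_of_ne_zero hB)
  have : FiniteDimensional (FractionRing R) (FractionRing C) :=
    Module.finite_of_finrank_pos (eC ▸ Nat.pos_of_ne_zero hC)
  rw [← eA, ← eB, ← eC]
  exact finrank_eq_mul_of_isFractionRing hf hg hsup hinf hG

/-- Linear disjointness for commuting commutative subrings of a domain. -/
theorem relDim_sup_eq_mul {D : Type*} [Ring D] [IsDomain D] (K L : Subring D)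
    (hK : ∀ x ∈ K, ∀ y ∈ K, x * y = y * x) (hL : ∀ x ∈ L, ∀ y ∈ L, x * y = y * x)
    (hcomm : ∀ x ∈ K, ∀ y ∈ L, x * y = y * x) (hGal : IsGaloisExt (K ⊓ L) L) :
    relDim (K ⊓ L) (K ⊔ L) = relDim (K ⊓ L) K * relDim (K ⊓ L) L := by
  have hKL : ∀ x ∈ K ⊔ L, ∀ y ∈ K ⊔ L, x * y = y * x := by
    have h1 : K ⊔ L ≤ Subring.centralizer (K ∪ L : Set D) := by
      refine sup_le (fun x hx g hg => ?_) fun x hx g hg => ?_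
      · exact hg.elim (fun h => hK g h x hx) fun h => (hcomm x hx g h).symm
      · exact hg.elim (fun h => hcomm g h x hx) fun h => hL g h x hx
    have h2 : K ⊔ L ≤ Subring.centralizer (K ⊔ L : Subring D) := by
      refine sup_le (fun x hx g hg => ?_) fun x hx g hg => ?_
      · exact (h1 hg x (.inl hx)).symm
      · exact (h1 hg x (.inr hx)).symm
    exact fun x hx y hy => h2 hy x hx
  let _ : CommRing ↥(K ⊔ L) :=
    { (inferInstance : Ring ↥(K ⊔ L)) with
      mul_comm := fun x y => Subtype.ext (hKL x x.2 y y.2) }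
  let E : Subring ↥(K ⊔ L) := (K ⊓ L).comap (K ⊔ L).subtype
  let K' : Subalgebra E ↥(K ⊔ L) :=
    { K.comap (K ⊔ L).subtype with algebraMap_mem' := fun r => r.2.1 }
  let L' : Subalgebra E ↥(K ⊔ L) :=
    { L.comap (K ⊔ L).subtype with algebraMap_mem' := fun r => r.2.2 }
  have hsup : K' ⊔ L' = ⊤ := by
    rw [eq_top_iff]
    rintro ⟨x, hx⟩ -
    have hle : K ⊔ L ≤ (K' ⊔ L').toSubring.map (K ⊔ L).subtype := by
      refine sup_le (fun y hy => ?_) fun y hy => ?_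
      · exact ⟨⟨y, (le_sup_left : K ≤ K ⊔ L) hy⟩, (le_sup_left : K' ≤ K' ⊔ L') hy, rfl⟩
      · exact ⟨⟨y, (le_sup_right : L ≤ K ⊔ L) hy⟩, (le_sup_right : L' ≤ K' ⊔ L') hy, rfl⟩
    obtain ⟨y, hy, hyx⟩ := hle hx
    obtain rfl : y = ⟨x, hx⟩ := Subtype.ext hyx
    exact hy
  have hinf : K' ⊓ L' = ⊥ := by
    rw [eq_bot_iff]
    rintro x ⟨hx1, hx2⟩
    exact Algebra.mem_bot.mpr ⟨⟨x, hx1, hx2⟩, rfl⟩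
  let eK : K ≃+* K' :=
    { toFun := fun x => ⟨⟨x, (le_sup_left : K ≤ K ⊔ L) x.2⟩, x.2⟩
      invFun := fun x => ⟨x.1.1, x.2⟩
      left_inv := fun _ => rfl
      right_inv := fun _ => rfl
      map_mul' := fun _ _ => rfl
      map_add' := fun _ _ => rfl }
  let eL : L ≃+* L' :=
    { toFun := fun x => ⟨⟨x, (le_sup_right : L ≤ K ⊔ L) x.2⟩, x.2⟩
      invFun := fun x => ⟨x.1.1, x.2⟩
      left_inv := fun _ => rfl
      right_inv := fun _ => rfl
      map_mul' := fun _ _ => rfl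
      map_add' := fun _ _ => rfl }
  have hfK : relDim (K ⊓ L) K = Module.finrank E K' := by
    refine congrArg Cardinal.toNat (rank_eq_of_equiv_equiv
      (fun x => ⟨⟨x.1.1, (le_sup_left : K ≤ K ⊔ L) x.1.2⟩, x.2⟩) eK.toAddEquiv
      ⟨fun x y h => ?_, fun x => ⟨⟨⟨x.1.1, x.2.1⟩, x.2⟩, rfl⟩⟩ fun _ _ => rfl)
    exact Subtype.ext (Subtype.ext (congrArg (fun z : E => (z.1.1 : D)) h))
  have hfL : relDim (K ⊓ L) L = Module.finrank E L' := by
    refine congrArg Cardinal.toNat (rank_eq_of_equiv_equiv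
      (fun x => ⟨⟨x.1.1, (le_sup_right : L ≤ K ⊔ L) x.1.2⟩, x.2⟩) eL.toAddEquiv
      ⟨fun x y h => ?_, fun x => ⟨⟨⟨x.1.1, x.2.2⟩, x.2⟩, rfl⟩⟩ fun _ _ => rfl)
    exact Subtype.ext (Subtype.ext (congrArg (fun z : E => (z.1.1 : D)) h))
  rw [hfK, hfL, mul_comm]
  refine finrank_eq_finrank_mul_finrank (f := L'.val) (g := K'.val) Subtype.val_injective
    Subtype.val_injective ?_ ?_ fun x hx => ?_
  · rwa [Subalgebra.range_val, Subalgebra.range_val, sup_comm L' K']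
  · rwa [Subalgebra.range_val, Subalgebra.range_val, inf_comm L' K']
  have hfix : (x.1.1 : D) ∈ K ⊓ L := by
    refine hGal.2 (eL.symm x) fun σ hσ => ?_
    let τ : L' ≃ₐ[E] L' := AlgEquiv.ofRingEquiv (f := (eL.symm.trans σ).trans eL) fun r => by
      change eL (σ (eL.symm (algebraMap E L' r))) = algebraMap E L' r
      rw [hσ (eL.symm (algebraMap E L' r)) r.2, RingEquiv.apply_symm_apply]
    have hτ : eL (σ (eL.symm x)) = x := hx τ
    rw [RingEquiv.eq_symm_apply, hτ]
  exact Algebra.mem_bot.mpr ⟨⟨x.1, hfix⟩, rfl⟩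

/-- linear disjointness: commuting graded subfields `K`, `L` of a
graded division algebra `D` over `F ⊆ Z(D)`, with `L/K ⊓ L` Galois, are linearly
disjoint over `K ⊓ L`; equivalently `[K⬝L : K∩L] = [K : K∩L]⬝[L : K∩L]`. -/
theorem stmt_4 {Γ : Type*} [AddCommGroup Γ] [DecidableEq Γ] {D : Type*} [Ring D]
    (hΓ : TorsionFree Γ) (𝒜 : Γ → AddSubgroup D) [GradedRing 𝒜]
    (hD : IsGradedDivisionRing 𝒜)
    (F : Subring D) (hF : IsGradedSubfield 𝒜 F) (hFcen : F ≤ Subring.center D)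
    (hfin : finiteOver (Subring.center D))
    (K L : Subring D) (hK : IsGradedSubfield 𝒜 K) (hL : IsGradedSubfield 𝒜 L)
    (hFK : F ≤ K) (hFL : F ≤ L)
    (hcomm : ∀ x ∈ K, ∀ y ∈ L, x * y = y * x)
    (hGal : IsGaloisExt (K ⊓ L) L) :
    relDim (K ⊓ L) (K ⊔ L) = relDim (K ⊓ L) K * relDim (K ⊓ L) L := by
  have := hD.isDomain hΓ 𝒜
  exact relDim_sup_eq_mul K L hK.2 hL.2 hcomm hGal

end GradedDivPaper
end
end

section
/- Let \(\mathsf{F}\subseteq\mathsf{K}\subseteq\mathsf{M}\) be graded fields with \(\mathsf{M}\) finite over \(\mathsf{F}\) and \(\mathsf{M}\) totally ramified over \(\mathsf{K}\). If \(\mathsf{M}/\mathsf{F}\) is normal, then \(\mathsf{K}/\mathsf{F}\) is normal; if \(\mathsf{M}/\mathsf{F}\) is Galois, then \(\mathsf{K}/\mathsf{F}\) is Galois. -/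
noncomputable section

namespace GradedDivPaper

open DirectSum Polynomial

/-- Torsion-free abelian groups embed into linearly ordered abelian groups. -/
theorem TorsionFree.exists_injective_hom.{u} {Γ : Type u} [AddCommGroup Γ] (hΓ : TorsionFree Γ) :
    ∃ (Λ : Type u) (_ : AddCommGroup Λ) (_ : LinearOrder Λ) (_ : IsOrderedAddMonoid Λ)
      (φ : Γ →+ Λ), Function.Injective φ := by
  have : IsAddTorsionFree Γ := ⟨fun n hn x y hxy ↦ by
    have h : n • (x - y) = 0 := by simpa [smul_sub, sub_eq_zero] using hxy
    exact sub_eq_zero.1 (hΓ _ n hn h)⟩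
  let b := Module.Basis.ofVectorSpace ℚ (DivisibleHull Γ)
  let _ : LinearOrder (Module.Basis.ofVectorSpaceIndex ℚ (DivisibleHull Γ)) :=
    IsWellOrder.linearOrder WellOrderingRel
  refine ⟨Lex (Module.Basis.ofVectorSpaceIndex ℚ (DivisibleHull Γ) →₀ ℚ), inferInstance,
    inferInstance, inferInstance,
    { toFun x := toLex (b.repr (x : DivisibleHull Γ))
      map_zero' := ?_
      map_add' x y := ?_ }, ?_⟩
  · have : ((0 : Γ) : DivisibleHull Γ) = 0 := (DivisibleHull.coeAddMonoidHom Γ).map_zero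
    rw [this, map_zero]
    rfl
  · rw [DivisibleHull.coe_add, map_add]
    rfl
  · intro x y h
    exact DivisibleHull.coe_injective (b.repr.injective (toLex.injective h))

section Components

variable {Γ : Type*} [AddCommGroup Γ] [DecidableEq Γ] {M : Type*} [CommRing M]
  (𝒜 : Γ → AddSubgroup M) [GradedRing 𝒜]

theorem decompose_mul_eq_sum [∀ (i) (x : 𝒜 i), Decidable (x ≠ 0)] (x y : M) (k : Γ) :
    (decompose 𝒜 (x * y) k : M) =
      ∑ i ∈ (decompose 𝒜 x).support, (decompose 𝒜 x i : M) * decompose 𝒜 y (k - i) := by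
  conv_lhs => rw [← sum_support_decompose 𝒜 x, Finset.sum_mul, decompose_sum]
  rw [DFinsupp.finsetSum_apply, AddSubmonoidClass.coe_finsetSum]
  refine Finset.sum_congr rfl fun i _ ↦ ?_
  conv_lhs => rw [show k = i + (k - i) by abel]
  exact coe_decompose_mul_add_of_left_mem 𝒜 (decompose 𝒜 x i).2

variable {Λ : Type*} [AddCommGroup Λ] [LinearOrder Λ] [IsOrderedAddMonoid Λ] {φ : Γ →+ Λ}

variable {𝒜} in
theorem decompose_mul_eq_zero {x y : M} {α β k : Γ}
    (hx : ∀ i, φ α < φ i → (decompose 𝒜 x i : M) = 0)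
    (hy : ∀ i, φ β < φ i → (decompose 𝒜 y i : M) = 0) (hk : φ (α + β) < φ k) :
    (decompose 𝒜 (x * y) k : M) = 0 := by
  classical
  rw [decompose_mul_eq_sum]
  refine Finset.sum_eq_zero fun i _ ↦ ?_
  by_cases hi : φ α < φ i
  · rw [hx i hi, zero_mul]
  · rw [hy (k - i), mul_zero]
    rw [map_sub, lt_sub_iff_add_lt]
    rw [map_add] at hk
    calc φ β + φ i ≤ φ β + φ α := by gcongr; exact not_lt.1 hi
      _ < φ k := by rwa [add_comm]

variable {𝒜} in
theorem decompose_mul_eq_mul (hφ : Function.Injective φ) {x y : M} {α β : Γ}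
    (hx : ∀ i, φ α < φ i → (decompose 𝒜 x i : M) = 0)
    (hy : ∀ i, φ β < φ i → (decompose 𝒜 y i : M) = 0) :
    (decompose 𝒜 (x * y) (α + β) : M) = decompose 𝒜 x α * decompose 𝒜 y β := by
  classical
  rw [decompose_mul_eq_sum, Finset.sum_eq_single α]
  · rw [add_sub_cancel_left]
  · intro i _ hi
    rcases lt_or_gt_of_ne (hφ.ne hi) with h | h
    · rw [hy, mul_zero]
      rw [map_sub, map_add, lt_sub_iff_add_lt, add_comm]
      gcongr
    · rw [hx i h, zero_mul]
  · intro h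
    rw [DFinsupp.notMem_support_iff.1 h, ZeroMemClass.coe_zero, zero_mul]

variable {𝒜} in
theorem decompose_pow_eq_zero {x : M} {α : Γ}
    (hx : ∀ i, φ α < φ i → (decompose 𝒜 x i : M) = 0) (n : ℕ) :
    ∀ k, φ (n • α) < φ k → (decompose 𝒜 (x ^ n) k : M) = 0 := by
  induction n with
  | zero =>
    intro k hk
    rw [pow_zero, decompose_of_mem_ne 𝒜 SetLike.GradedOne.one_mem]
    rintro rfl
    simp at hk
  | succ n ih =>
    intro k hk
    rw [pow_succ]
    exact decompose_mul_eq_zero ih hx (by rwa [← succ_nsmul])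

variable {𝒜} in
theorem decompose_pow_eq_pow (hφ : Function.Injective φ) {x : M} {α : Γ}
    (hx : ∀ i, φ α < φ i → (decompose 𝒜 x i : M) = 0) (n : ℕ) :
    (decompose 𝒜 (x ^ n) (n • α) : M) = (decompose 𝒜 x α : M) ^ n := by
  induction n with
  | zero => rw [pow_zero, zero_nsmul, pow_zero, decompose_of_mem_same 𝒜 SetLike.GradedOne.one_mem]
  | succ n ih =>
    rw [pow_succ, succ_nsmul, decompose_mul_eq_mul hφ (decompose_pow_eq_zero hx n) hx, ih, pow_succ]

/-- A polynomial over a subring is homogeneous of weight `γ` when it is homogeneous after giving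
the variable degree `γ`, with total degree that of its leading monic term. -/
def IsHomogeneousOfWeight {F : Subring M} (γ : Γ) (p : F[X]) : Prop :=
  ∀ i : ℕ, (p.coeff i : M) ∈ 𝒜 ((p.natDegree : ℤ) • γ - (i : ℤ) • γ)

variable {𝒜}

theorem decompose_root_eq_zero (hM : IsGradedDivisionRing 𝒜) (hφ : Function.Injective φ)
    {F : Subring M} {p : F[X]} {γ : Γ} (hp : p.Monic) (hhom : IsHomogeneousOfWeight 𝒜 γ p)
    {a : M} (ha : p.eval₂ F.subtype a = 0) (k : Γ) (hk : φ γ < φ k) :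
    (decompose 𝒜 a k : M) = 0 := by
  classical
  by_contra hne
  have hmem : k ∈ (decompose 𝒜 a).support := by
    rw [DFinsupp.mem_support_iff]
    exact fun h ↦ hne (by rw [h]; rfl)
  obtain ⟨δ, hδ, hmax⟩ := Finset.exists_max_image _ φ ⟨k, hmem⟩
  have hγδ : φ γ < φ δ := hk.trans_le (hmax k hmem)
  have htop : ∀ i, φ δ < φ i → (decompose 𝒜 a i : M) = 0 := fun i hi ↦ by
    by_contra h
    refine (hmax i ?_).not_gt hi
    rw [DFinsupp.mem_support_iff]
    exact fun h' ↦ h (by rw [h']; rfl)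
  have : Nontrivial M := ⟨0, 1, hM.1⟩
  have hunit : IsUnit (decompose 𝒜 a δ : M) := by
    refine hM.2 δ _ (decompose 𝒜 a δ).2 fun h ↦ ?_
    rw [DFinsupp.mem_support_iff] at hδ
    exact hδ (Subtype.ext h)
  refine (hunit.pow p.natDegree).ne_zero ?_
  rw [← decompose_pow_eq_pow hφ htop]
  have h0 : (decompose 𝒜 (p.eval₂ F.subtype a) (p.natDegree • δ) : M) = 0 := by rw [ha]; simp
  rw [eval₂_eq_sum_range, Finset.sum_range_succ, decompose_add, DirectSum.add_apply, AddSubgroup.coe_add,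
    decompose_sum, DFinsupp.finsetSum_apply, AddSubmonoidClass.coe_finsetSum,
    Finset.sum_eq_zero, zero_add] at h0
  · simpa [hp.coeff_natDegree] using h0
  · intro i hi
    have hi := Finset.mem_range.1 hi
    rw [show p.natDegree • δ = ((p.natDegree : ℤ) • γ - (i : ℤ) • γ) +
      (p.natDegree • δ - ((p.natDegree : ℤ) • γ - (i : ℤ) • γ)) by abel]
    refine (coe_decompose_mul_add_of_left_mem 𝒜 (hhom i)).trans ?_
    rw [decompose_pow_eq_zero htop, mul_zero]
    obtain ⟨m, hm⟩ := Nat.exists_eq_add_of_lt hi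
    rw [hm]
    have := nsmul_lt_nsmul_right (n := m + 1) (by simp) hγδ
    simp only [map_sub, map_nsmul, natCast_zsmul]
    rw [add_assoc, add_nsmul (φ δ), add_nsmul (φ γ), add_sub_cancel_left, add_sub_assoc]
    exact lt_add_of_pos_right _ (sub_pos.2 this)

/-- Roots of a monic polynomial homogeneous of weight `γ` are homogeneous of degree `γ`. -/
theorem mem_of_isHomogeneousOfWeight (hΓ : TorsionFree Γ) (hM : IsGradedDivisionRing 𝒜)
    {F : Subring M} {p : F[X]} {γ : Γ} (hp : p.Monic) (hhom : IsHomogeneousOfWeight 𝒜 γ p)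
    {a : M} (ha : p.eval₂ F.subtype a = 0) : a ∈ 𝒜 γ := by
  classical
  obtain ⟨Λ, _, _, _, φ, hφ⟩ := hΓ.exists_injective_hom
  have key : ∀ k, k ≠ γ → (decompose 𝒜 a k : M) = 0 := fun k hk ↦ by
    rcases lt_or_gt_of_ne (hφ.ne hk) with h | h
    · exact decompose_root_eq_zero hM (φ := -φ) (neg_injective.comp hφ) hp hhom ha k
        (by simpa using h)
    · exact decompose_root_eq_zero hM hφ hp hhom ha k h
  rw [← sum_support_decompose 𝒜 a]
  refine sum_mem fun k _ ↦ ?_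
  by_cases hk : k = γ
  · rw [← hk]
    exact (decompose 𝒜 a k).2
  · rw [key k hk]
    exact zero_mem _

/-- The minimal polynomial of a homogeneous element over a graded subfield is homogeneous. -/
theorem IsMinPolyOf.isHomogeneousOfWeight {F : Subring M} (hF : IsGradedSubfield 𝒜 F) {c : M}
    {γ : Γ} (hc : c ∈ 𝒜 γ) {p : F[X]} (hp : IsMinPolyOf F c p) :
    IsHomogeneousOfWeight 𝒜 γ p := by
  classical
  obtain ⟨hmonic, hroot, hmin⟩ := hp
  set n := p.natDegree with hn
  have key : ∀ δ, δ ≠ (n : ℤ) • γ → ∀ i < n,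
      (decompose 𝒜 (p.coeff i : M) (δ - i • γ) : M) = 0 := by
    intro δ hδ
    let q : F[X] := ∑ i ∈ Finset.range n,
      C ⟨_, hF.1.1 (p.coeff i : M) (p.coeff i).2 (δ - i • γ)⟩ * X ^ i
    have hcoeff : ∀ i < n,
        (q.coeff i : M) = decompose 𝒜 (p.coeff i : M) (δ - i • γ) := by
      intro i hi
      simp [q, coeff_C_mul, coeff_X_pow, hi]
    have hdeg : q.degree < n := by
      refine (degree_sum_le _ _).trans_lt ((Finset.sup_lt_iff (WithBot.bot_lt_coe n)).2 ?_)
      exact fun i hi ↦ (degree_C_mul_X_pow_le _ _).trans_lt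
        (WithBot.coe_lt_coe.2 (Finset.mem_range.1 hi))
    have hq : q.eval₂ F.subtype c = 0 := by
      have h0 : (decompose 𝒜 (p.eval₂ F.subtype c) δ : M) = 0 := by rw [hroot]; simp
      have hpow : ∀ i : ℕ, c ^ i ∈ 𝒜 (i • γ) := fun i ↦ SetLike.pow_mem_graded i hc
      have hterm : ∀ i : ℕ, (decompose 𝒜 (F.subtype (p.coeff i) * c ^ i) δ : M) =
          decompose 𝒜 (p.coeff i : M) (δ - i • γ) * c ^ i := fun i ↦ by
        conv_lhs => rw [← sub_add_cancel δ (i • γ)]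
        exact coe_decompose_mul_add_of_right_mem 𝒜 (hpow i)
      rw [eval₂_eq_sum_range, Finset.sum_range_succ, decompose_add, DirectSum.add_apply,
        AddSubgroup.coe_add, decompose_sum, DFinsupp.finsetSum_apply,
        AddSubmonoidClass.coe_finsetSum, hterm, hmonic.coeff_natDegree, OneMemClass.coe_one,
        decompose_of_mem_ne 𝒜 SetLike.GradedOne.one_mem, zero_mul, add_zero] at h0
      · rw [← h0, eval₂_finsetSum]
        refine Finset.sum_congr rfl fun i _ ↦ ?_
        rw [hterm]
        simp
      · intro h
        rw [natCast_zsmul] at hδ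
        exact hδ (sub_eq_zero.1 h.symm)
    have hq0 : q = 0 := by
      by_contra hne
      have hlt : q.natDegree < n := (natDegree_lt_iff_degree_lt hne).2 hdeg
      have hlead : (q.leadingCoeff : M) ≠ 0 := fun h ↦
        hne (leadingCoeff_eq_zero.1 (Subtype.ext h))
      have hmem : (q.leadingCoeff : M) ∈ 𝒜 (δ - q.natDegree • γ) := by
        rw [leadingCoeff, hcoeff _ hlt]
        exact SetLike.coe_mem _
      obtain ⟨y, hyF, -, hy⟩ := hF.1.2 _ _ q.leadingCoeff.2 hmem hlead
      have hmon : (C (⟨y, hyF⟩ : F) * q).Monic :=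
        monic_C_mul_of_mul_leadingCoeff_eq_one (Subtype.ext hy)
      have hle := hmin _ hmon (by rw [eval₂_mul, hq, mul_zero])
      have hlt' : (C (⟨y, hyF⟩ : F) * q).degree < p.degree := by
        refine ((degree_mul_le _ _).trans (add_le_of_nonpos_left degree_C_le)).trans_lt (hdeg.trans_le ?_)
        rw [degree_eq_natDegree]
        intro h0
        simp [hn, h0] at hlt
      exact hle.not_gt hlt'
    intro i hi
    rw [← hcoeff i hi, hq0]
    simp
  intro i
  rcases lt_trichotomy i n with hi | hi | hi
  · rw [← sum_support_decompose 𝒜 (p.coeff i : M)]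
    refine sum_mem fun k _ ↦ ?_
    by_cases hk : k = (n : ℤ) • γ - (i : ℤ) • γ
    · rw [← hk]
      exact SetLike.coe_mem _
    · have := key (k + i • γ) (fun h ↦ hk (by rw [← h]; simp)) i hi
      rw [add_sub_cancel_right] at this
      rw [this]
      exact zero_mem _
  · rw [hi, hn, hmonic.coeff_natDegree, sub_self]
    exact SetLike.GradedOne.one_mem
  · rw [coeff_eq_zero_of_natDegree_lt hi]
    exact zero_mem _

theorem inv_mem_neg {c d : M} {γ : Γ} (hc : c ∈ 𝒜 γ) (hdc : d * c = 1) : d ∈ 𝒜 (-γ) := by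
  have h : (decompose 𝒜 d (-γ) : M) * c = 1 := by
    rw [← coe_decompose_mul_add_of_right_mem 𝒜 hc, neg_add_cancel, hdc,
      decompose_of_mem_same 𝒜 SetLike.GradedOne.one_mem]
  have : d = decompose 𝒜 d (-γ) :=
    calc d = (decompose 𝒜 d (-γ) * c) * d := by rw [h, one_mul]
      _ = decompose 𝒜 d (-γ) := by rw [mul_assoc, mul_comm c, hdc, mul_one]
  rw [this]
  exact SetLike.coe_mem _

/-- If `M/K` is totally ramified, the roots in `M` of the minimal polynomial over `F` of a
homogeneous element of `K` lie in `K`. -/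
theorem IsMinPolyOf.root_mem (hΓ : TorsionFree Γ) (hM : IsGradedDivisionRing 𝒜)
    {F K : Subring M} (hF : IsGradedSubfield 𝒜 F) (hK : IsGradedSubfield 𝒜 K)
    (htotram : grade0 𝒜 ≤ K) {c : M} (hcK : c ∈ K) {γ : Γ} (hc : c ∈ 𝒜 γ) {p : F[X]}
    (hp : IsMinPolyOf F c p) {a : M} (ha : p.eval₂ F.subtype a = 0) : a ∈ K := by
  by_cases h0 : c = 0
  · have hzero : c ∈ 𝒜 0 := h0 ▸ zero_mem _
    exact htotram (mem_of_isHomogeneousOfWeight hΓ hM hp.1 (hp.isHomogeneousOfWeight hF hzero) ha)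
  · obtain ⟨d, hdK, -, hdc⟩ := hK.1.2 γ c hcK hc h0
    have haγ := mem_of_isHomogeneousOfWeight hΓ hM hp.1 (hp.isHomogeneousOfWeight hF hc) ha
    have had : a * d ∈ K := htotram (by
      have := SetLike.mul_mem_graded haγ (inv_mem_neg hc hdc)
      rwa [add_neg_cancel] at this)
    have : a = a * d * c := by rw [mul_assoc, hdc, mul_one]
    rw [this]
    exact K.mul_mem had hcK

/-- If `M/K` is totally ramified, every endomorphism of `M` over `F` maps `K` into itself. -/
theorem map_mem_of_totallyRamified (hΓ : TorsionFree Γ) (hM : IsGradedDivisionRing 𝒜)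
    {F K : Subring M} (hF : IsGradedSubfield 𝒜 F) (hK : IsGradedSubfield 𝒜 K)
    (hfin : finiteOver F) (htotram : grade0 𝒜 ≤ K) (σ : M →+* M) (hσ : ∀ y ∈ F, σ y = y)
    {x : M} (hx : x ∈ K) : σ x ∈ K := by
  classical
  have : Module.Finite F M := hfin
  rw [← sum_support_decompose 𝒜 x, map_sum]
  refine sum_mem fun γ _ ↦ ?_
  set c : M := (decompose 𝒜 x γ : M)
  have hint : IsIntegral F c := Algebra.IsIntegral.isIntegral c
  have hmin : IsMinPolyOf F c (minpoly F c) :=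
    ⟨minpoly.monic hint, minpoly.aeval F c, fun q hq hq0 ↦ minpoly.min F c hq hq0⟩
  refine hmin.root_mem hΓ hM hF hK htotram (hK.1.1 x hx γ) (SetLike.coe_mem _) ?_
  have hcomp : σ.comp F.subtype = F.subtype := RingHom.ext fun y ↦ hσ y y.2
  have := congrArg σ hmin.2.1
  rwa [hom_eval₂, hcomp, map_zero] at this

theorem SplitsIn.of_roots_mem {F K : Subring M} (hFT : F ≤ ⊤) (hFK : F ≤ K) {p : F[X]}
    (hp : SplitsIn hFT p) (hroot : ∀ a, p.eval₂ F.subtype a = 0 → a ∈ K) : SplitsIn hFK p := by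
  obtain ⟨s, hs⟩ := hp
  have hmap : p.map F.subtype = (s.map fun a : (⊤ : Subring M) ↦ X - C (a : M)).prod := by
    have := congrArg (Polynomial.map (⊤ : Subring M).subtype) hs
    rw [Polynomial.map_map, Polynomial.map_list_prod, List.map_map] at this
    refine this.trans (congrArg List.prod (List.map_congr_left fun a _ ↦ ?_))
    simp
  have hsK : ∀ a ∈ s, (a : M) ∈ K := fun a ha ↦ by
    refine hroot a ?_
    rw [← eval_map, hmap, eval_list_prod, List.map_map]
    exact List.prod_eq_zero (List.mem_map.2 ⟨a, ha, by simp⟩)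
  refine ⟨s.attach.map fun a ↦ ⟨a.1, hsK a.1 a.2⟩, ?_⟩
  refine Polynomial.map_injective K.subtype Subtype.val_injective ?_
  rw [Polynomial.map_map, Polynomial.map_list_prod, List.map_map, List.map_map]
  refine hmap.trans (congrArg List.prod ?_)
  conv_lhs => rw [← List.attach_map_subtype_val s, List.map_map]
  exact List.map_congr_left fun a _ ↦ by simp

end Components

/-- for graded fields `F ⊆ K ⊆ M` with `M/F` finite and `M/K` totally
ramified, normality (resp. Galois-ness) of `M/F` descends to `K/F`. -/
theorem stmt_5 {Γ : Type*} [AddCommGroup Γ] [DecidableEq Γ] {M : Type*} [CommRing M]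
    (hΓ : TorsionFree Γ) (𝒜 : Γ → AddSubgroup M) [GradedRing 𝒜]
    (hM : IsGradedDivisionRing 𝒜)
    (F K : Subring M) (hF : IsGradedSubfield 𝒜 F) (hK : IsGradedSubfield 𝒜 K)
    (hFK : F ≤ K) (hfin : finiteOver F)
    (htotram : grade0 𝒜 ≤ K) :
    (IsNormalExtGr 𝒜 F ⊤ → IsNormalExtGr 𝒜 F K) ∧
      (IsGaloisExt F (⊤ : Subring M) → IsGaloisExt F K) := by
  refine ⟨fun ⟨hFT, hN⟩ ↦ ⟨hFK, fun c hc ⟨γ, hγ⟩ p hp ↦ ?_⟩, fun ⟨_, hG⟩ ↦ ⟨hFK, fun x hx ↦ ?_⟩⟩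
  · exact (hN c trivial ⟨γ, hγ⟩ p hp).of_roots_mem hFT hFK fun a ha ↦
      hp.root_mem hΓ hM hF hK htotram hc hγ ha
  · refine hG ⟨x, trivial⟩ fun σ hσ ↦ ?_
    let τ : M ≃+* M := (Subring.topEquiv.symm.trans σ).trans Subring.topEquiv
    have hτ : ∀ y ∈ F, τ y = y := fun y hy ↦ congrArg Subtype.val (hσ ⟨y, trivial⟩ hy)
    have hτ' : ∀ y ∈ F, τ.symm y = y := fun y hy ↦ by
      rw [RingEquiv.symm_apply_eq, hτ y hy]
    let ρ : K ≃+* K := RingEquiv.ofRingHom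
      ((τ.toRingHom.comp K.subtype).codRestrict K fun y ↦
        map_mem_of_totallyRamified hΓ hM hF hK hfin htotram τ.toRingHom hτ y.2)
      ((τ.symm.toRingHom.comp K.subtype).codRestrict K fun y ↦
        map_mem_of_totallyRamified hΓ hM hF hK hfin htotram τ.symm.toRingHom hτ' y.2)
      (RingHom.ext fun y ↦ Subtype.ext (τ.apply_symm_apply y))
      (RingHom.ext fun y ↦ Subtype.ext (τ.symm_apply_apply y))
    have hρ : τ x = x := congrArg Subtype.val (hx ρ fun y hy ↦ Subtype.ext (hτ y hy))
    exact Subtype.ext hρ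

end GradedDivPaper
end
end

section
/- Let \(\mathsf{D}\) be a finite-dimensional graded division algebra with center \(\mathsf{F}\), with canonical subalgebras \(\mathsf{U}=\mathsf{D}_0\otimes_{\mathsf{F}_0}\mathsf{F}\), \(\mathsf{Z}=Z(\mathsf{D}_0)\otimes_{\mathsf{F}_0}\mathsf{F}\), \(\mathsf{C}=C_{\mathsf{D}}(\mathsf{U})\). Then every maximal graded subfield \(\mathsf{T}\) of \(\mathsf{C}\) is Galois over \(\mathsf{F}\). -/
noncomputable section

namespace GradedDivPaper

section

variable {Γ : Type*} [AddCommGroup Γ] [DecidableEq Γ] {D : Type*} [Ring D]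
  {𝒜 : Γ → AddSubgroup D} [GradedRing 𝒜]

/-- The inverse of a homogeneous unit of degree `γ` is homogeneous of degree `-γ`. -/
theorem inv_mem_neg_grade {γ : Γ} (u : Dˣ) (hu : (u : D) ∈ 𝒜 γ) : (↑u⁻¹ : D) ∈ 𝒜 (-γ) := by
  have h := DirectSum.coe_decompose_mul_add_of_left_mem 𝒜 (j := -γ) (b := (↑u⁻¹ : D)) hu
  rw [Units.mul_inv, add_neg_cancel,
    DirectSum.decompose_of_mem_same 𝒜 (SetLike.one_mem_graded 𝒜)] at h
  rw [Units.inv_eq_of_mul_eq_one_right h.symm]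
  exact SetLike.coe_mem _

/-- The centralizer of a set closed under taking homogeneous components is a graded subring. -/
theorem isGradedSubring_centralizer {S : Set D}
    (hS : ∀ x ∈ S, ∀ γ : Γ, (DirectSum.decompose 𝒜 x γ : D) ∈ S) :
    IsGradedSubring 𝒜 (Subring.centralizer S) := by
  intro x hx γ
  rw [Subring.mem_centralizer_iff] at hx ⊢
  intro y hy
  classical
  rw [← DirectSum.sum_support_decompose 𝒜 y, Finset.sum_mul, Finset.mul_sum]
  refine Finset.sum_congr rfl fun δ _ => ?_
  have hmem : (DirectSum.decompose 𝒜 y δ : D) ∈ 𝒜 δ := SetLike.coe_mem _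
  rw [← DirectSum.coe_decompose_mul_add_of_left_mem 𝒜 hmem,
    ← DirectSum.coe_decompose_mul_add_of_right_mem 𝒜 hmem, hx _ (hS y hy δ), add_comm]

theorem IsGradedSubring.inf {E E' : Subring D} (h : IsGradedSubring 𝒜 E)
    (h' : IsGradedSubring 𝒜 E') : IsGradedSubring 𝒜 (E ⊓ E') :=
  fun x hx γ => ⟨h x hx.1 γ, h' x hx.2 γ⟩

theorem isGradedSubring_grade0 : IsGradedSubring 𝒜 (grade0 𝒜) := by
  intro x hx γ
  by_cases h : γ = 0
  · subst h
    exact SetLike.coe_mem (DirectSum.decompose 𝒜 x 0)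
  · rw [DirectSum.decompose_of_mem_ne 𝒜 (show x ∈ 𝒜 0 from hx) (Ne.symm h)]
    exact zero_mem _

theorem units_inv_mem_centralizer {S : Set D} (u : Dˣ)
    (hu : (u : D) ∈ Subring.centralizer S) : (↑u⁻¹ : D) ∈ Subring.centralizer S := by
  rw [Subring.mem_centralizer_iff] at hu ⊢
  exact fun y hy => Commute.units_inv_right (hu y hy)

/-- Conjugation by a homogeneous unit preserves each homogeneous component. -/
theorem conj_mem_grade {γ δ : Γ} (u : Dˣ) (hu : (u : D) ∈ 𝒜 δ) {x : D} (hx : x ∈ 𝒜 γ) :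
    (u : D) * x * ↑u⁻¹ ∈ 𝒜 γ := by
  have h := SetLike.mul_mem_graded (SetLike.mul_mem_graded hu hx) (inv_mem_neg_grade u hu)
  rwa [add_neg_cancel_comm] at h

variable {F : Subring D}

theorem Cc_eq_centralizer_grade0 (hF : F = Subring.center D) :
    Cc 𝒜 F = Subring.centralizer (grade0 𝒜 : Set D) := by
  apply le_antisymm
  · exact Subring.centralizer_le _ _ (fun x hx => (le_sup_left : grade0 𝒜 ≤ Uc 𝒜 F) hx)
  · intro x hx
    have h : Uc 𝒜 F ≤ Subring.centralizer {x} := by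
      refine sup_le (fun y hy => ?_) (fun y hy => ?_)
      · rw [Subring.mem_centralizer_iff]
        rintro _ rfl
        exact (Subring.mem_centralizer_iff.1 hx y hy).symm
      · exact Subring.center_le_centralizer _ (hF ▸ hy)
    exact Subring.mem_centralizer_iff.2 fun y hy =>
      (Subring.mem_centralizer_iff.1 (h hy) x rfl).symm

/-- Conjugation by a homogeneous unit preserves the canonical subalgebra `𝖢`. -/
theorem conj_mem_Cc (hF : F = Subring.center D) {δ : Γ} (u : Dˣ) (hu : (u : D) ∈ 𝒜 δ)
    {x : D} (hx : x ∈ Cc 𝒜 F) : (u : D) * x * ↑u⁻¹ ∈ Cc 𝒜 F := by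
  rw [Cc_eq_centralizer_grade0 hF, Subring.mem_centralizer_iff] at hx ⊢
  intro y hy
  have h := hx ((↑u⁻¹ : D) * y * u) (conj_mem_grade (𝒜 := 𝒜) u⁻¹ (inv_mem_neg_grade u hu) hy)
  calc y * (u * x * ↑u⁻¹) = u * ((↑u⁻¹ * y * u) * x) * ↑u⁻¹ := by simp [mul_assoc]
    _ = u * (x * (↑u⁻¹ * y * u)) * ↑u⁻¹ := by rw [h]
    _ = u * x * ↑u⁻¹ * y := by simp [mul_assoc]

/-- A maximal graded subfield of `𝖢` contains the center of `𝖢`. -/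
theorem IsMaxGradedSubfieldOf.mem_of_commute (hF : F = Subring.center D)
    (hD : IsGradedDivisionRing 𝒜) {T : Subring D}
    (hT : IsMaxGradedSubfieldOf 𝒜 (Cc 𝒜 F) T) {z : D} (hz : z ∈ Cc 𝒜 F)
    (hcomm : ∀ c ∈ Cc 𝒜 F, c * z = z * c) : z ∈ T := by
  obtain ⟨⟨⟨hTgr, -⟩, hTcomm⟩, hTC, hmax⟩ := hT
  let M : Subring D := Subring.centralizer (T : Set D) ⊓ Cc 𝒜 F
  let T' : Subring D := M ⊓ Subring.centralizer (M : Set D)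
  have hCgr : IsGradedSubring 𝒜 (Cc 𝒜 F) := by
    rw [Cc_eq_centralizer_grade0 hF]
    exact isGradedSubring_centralizer isGradedSubring_grade0
  have hMgr : IsGradedSubring 𝒜 M := (isGradedSubring_centralizer hTgr).inf hCgr
  have hT'gr : IsGradedSubring 𝒜 T' := hMgr.inf (isGradedSubring_centralizer hMgr)
  have hfield : IsGradedSubfield 𝒜 T' := by
    refine ⟨⟨hT'gr, fun γ x hx hxγ hx0 => ?_⟩, fun x hx y hy => ?_⟩
    · obtain ⟨u, rfl⟩ := hD.2 γ x hxγ hx0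
      exact ⟨↑u⁻¹, ⟨⟨units_inv_mem_centralizer u hx.1.1, units_inv_mem_centralizer u hx.1.2⟩,
        units_inv_mem_centralizer u hx.2⟩, u.mul_inv, u.inv_mul⟩
    · exact Subring.mem_centralizer_iff.1 hy.2 x hx.1
  have hTT' : T ≤ T' := fun t ht =>
    ⟨⟨Subring.mem_centralizer_iff.2 fun s hs => hTcomm s hs t ht, hTC ht⟩,
      Subring.mem_centralizer_iff.2 fun m hm => (Subring.mem_centralizer_iff.1 hm.1 t ht).symm⟩
  rw [← hmax T' hfield (fun x hx => hx.1.2) hTT']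
  exact ⟨⟨Subring.mem_centralizer_iff.2 fun s hs => hcomm s (hTC hs), hz⟩,
    Subring.mem_centralizer_iff.2 fun m hm => hcomm m hm.2⟩

/-- Conjugation by a homogeneous unit preserves every maximal graded subfield of `𝖢`. -/
theorem IsMaxGradedSubfieldOf.conj_mem (hF : F = Subring.center D)
    (hD : IsGradedDivisionRing 𝒜) {T : Subring D}
    (hT : IsMaxGradedSubfieldOf 𝒜 (Cc 𝒜 F) T) {δ : Γ} (u : Dˣ) (hu : (u : D) ∈ 𝒜 δ)
    {t : D} (ht : t ∈ T) : (u : D) * t * ↑u⁻¹ ∈ T := by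
  classical
  rw [← DirectSum.sum_support_decompose 𝒜 t, Finset.mul_sum, Finset.sum_mul]
  refine Subring.sum_mem _ fun γ _ => ?_
  have hsT : (DirectSum.decompose 𝒜 t γ : D) ∈ T := hT.1.1.1 t ht γ
  have hsγ : (DirectSum.decompose 𝒜 t γ : D) ∈ 𝒜 γ := SetLike.coe_mem _
  generalize (DirectSum.decompose 𝒜 t γ : D) = s at hsT hsγ
  by_cases hs0 : s = 0
  · simp [hs0]
  obtain ⟨r, hrT, hsr, hrs⟩ := hT.1.1.2 γ s hsT hsγ hs0
  have hr : r ∈ 𝒜 (-γ) := inv_mem_neg_grade (⟨s, r, hsr, hrs⟩ : Dˣ) hsγ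
  have hC : (u : D) * s * ↑u⁻¹ * r ∈ Cc 𝒜 F :=
    mul_mem (conj_mem_Cc hF u hu (hT.2.1 hsT)) (hT.2.1 hrT)
  have h0 : (u : D) * s * ↑u⁻¹ * r ∈ grade0 𝒜 := by
    have h := SetLike.mul_mem_graded (conj_mem_grade u hu hsγ) hr
    rwa [add_neg_cancel] at h
  have hz : (u : D) * s * ↑u⁻¹ * r ∈ T := by
    refine hT.mem_of_commute hF hD hC fun c hc => ?_
    rw [Cc_eq_centralizer_grade0 hF] at hc
    exact (Subring.mem_centralizer_iff.1 hc _ h0).symm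
  have h := mul_mem hz hsT
  rwa [mul_assoc, hrs, mul_one] at h

end

/-- Conjugation by a unit, as an automorphism of a subring stable under it and its inverse. -/
def conjRingEquiv {D : Type*} [Ring D] (T : Subring D) (u : Dˣ)
    (h : ∀ t ∈ T, (u : D) * t * ↑u⁻¹ ∈ T) (h' : ∀ t ∈ T, (↑u⁻¹ : D) * t * u ∈ T) :
    T ≃+* T where
  toFun t := ⟨u * t * ↑u⁻¹, h t t.2⟩
  invFun t := ⟨↑u⁻¹ * t * u, h' t t.2⟩
  left_inv t := Subtype.ext (by simp [mul_assoc])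
  right_inv t := Subtype.ext (by simp [mul_assoc])
  map_mul' s t := Subtype.ext (by simp [mul_assoc])
  map_add' s t := Subtype.ext (by simp [mul_add, add_mul])

/-- every maximal graded subfield `T` of the canonical subalgebra `𝖢`
is Galois over the center `F`. -/
theorem stmt_7 {Γ : Type*} [AddCommGroup Γ] [DecidableEq Γ] {D : Type*} [Ring D]
    (hΓ : TorsionFree Γ) (𝒜 : Γ → AddSubgroup D) [GradedRing 𝒜]
    (hD : IsGradedDivisionRing 𝒜)
    (F : Subring D) (hFcen : F = Subring.center D) (hfin : finiteOver F)
    (T : Subring D) (hT : IsMaxGradedSubfieldOf 𝒜 (Cc 𝒜 F) T) :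
    IsGaloisExt F T := by
  refine ⟨fun z hz => ?_, fun x hx => ?_⟩
  · rw [hFcen] at hz
    exact hT.mem_of_commute hFcen hD (Subring.center_le_centralizer _ hz)
      fun c _ => Subring.mem_center_iff.1 hz c
  · rw [hFcen, Subring.mem_center_iff]
    intro y
    classical
    rw [← DirectSum.sum_support_decompose 𝒜 y, Finset.sum_mul, Finset.mul_sum]
    refine Finset.sum_congr rfl fun δ _ => ?_
    have hmem : (DirectSum.decompose 𝒜 y δ : D) ∈ 𝒜 δ := SetLike.coe_mem _
    generalize (DirectSum.decompose 𝒜 y δ : D) = s at hmem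
    by_cases hs0 : s = 0
    · simp [hs0]
    obtain ⟨u, rfl⟩ := hD.2 δ s hmem hs0
    have hfix := hx (conjRingEquiv T u (fun t ht => hT.conj_mem hFcen hD u hmem ht)
      (fun t ht => hT.conj_mem hFcen hD u⁻¹ (inv_mem_neg_grade u hmem) ht)) ?_
    · have h : (u : D) * x * ↑u⁻¹ = x := congrArg Subtype.val hfix
      exact (Units.mul_inv_eq_iff_eq_mul u).1 h
    · intro z hz
      rw [hFcen] at hz
      refine Subtype.ext ?_
      change (u : D) * z * ↑u⁻¹ = z
      rw [Subring.mem_center_iff.1 hz u, Units.mul_inv_cancel_right]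

end GradedDivPaper
end
end
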